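/- arXiv:1209.4438 — 3 statements merged into one kernel-verified Lean document; each statement's English description precedes it below -/
import Mathlib

section
/- Let q be a prime power satisfying q ≡ 1 (mod 8) which is not a power of 3. Then there exists a strictly 4-sparse 4-cycle system of order q. -/
open Finset

/-- The edge set of the 4-cycle `(a, b, c, d)`: edges {a,b}, {b,c}, {c,d}, {d,a}. -/
def cycEdges {V : Type*} [DecidableEq V] (a b c d : V) : Finset (Sym2 V) :=
  {s(a, b), s(b, c), s(c, d), s(d, a)}

/-- `E` is the edge set of a 4-cycle on four distinct vertices. -/
def IsFourCycle {V : Type*} [DecidableEq V] (E : Finset (Sym2 V)) : Prop :=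
  ∃ a b c d : V, ([a, b, c, d] : List V).Nodup ∧ E = cycEdges a b c d

/-- The set of vertices covered by a set of edges. -/
def edgeVerts {V : Type*} [DecidableEq V] (E : Finset (Sym2 V)) : Finset V :=
  E.sup (Sym2.lift ⟨fun x y => ({x, y} : Finset V), fun x y => Finset.pair_comm x y⟩)

/-- A `(k, l)`-configuration: a set of `l` pairwise edge-disjoint 4-cycles whose
union contains exactly `k` vertices. -/
def IsConfiguration {V : Type*} [DecidableEq V] (k l : ℕ)
    (D : Finset (Finset (Sym2 V))) : Prop :=
  D.card = l ∧ (∀ E ∈ D, IsFourCycle E) ∧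
    (∀ E ∈ D, ∀ F ∈ D, E ≠ F → Disjoint E F) ∧
    (D.sup edgeVerts).card = k

/-- `C` is a 4-cycle system: a collection of 4-cycles whose edge sets partition
the edge set of the complete graph on `V`. -/
def IsFourCycleSystem {V : Type*} [DecidableEq V] (C : Finset (Finset (Sym2 V))) : Prop :=
  (∀ E ∈ C, IsFourCycle E) ∧ ∀ e : Sym2 V, ¬ e.IsDiag → ∃! E, E ∈ C ∧ e ∈ E

/-- `C` is a 4-cycle packing: a set of pairwise edge-disjoint 4-cycles. -/
def IsFourCyclePacking {V : Type*} [DecidableEq V] (C : Finset (Finset (Sym2 V))) : Prop :=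
  (∀ E ∈ C, IsFourCycle E) ∧ ∀ E ∈ C, ∀ F ∈ C, E ≠ F → Disjoint E F

/-- `C` is `r`-sparse: it contains no `(j+3, j)`-configuration for `2 ≤ j ≤ r`. -/
def RSparse {V : Type*} [DecidableEq V] (r : ℕ) (C : Finset (Finset (Sym2 V))) : Prop :=
  ∀ j, 2 ≤ j → j ≤ r → ∀ D ⊆ C, ¬ IsConfiguration (j + 3) j D

/-- Two 4-cycles form a double-diamond: they are `(a,b,c,d)` and `(a,e,c,f)`,
sharing the diagonal {a,c}. -/
def IsDoubleDiamond {V : Type*} [DecidableEq V] (E F : Finset (Sym2 V)) : Prop :=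
  ∃ a b c d e f : V, ([a, b, c, d, e, f] : List V).Nodup ∧
    E = cycEdges a b c d ∧ F = cycEdges a e c f

/-- `C` is D-avoiding: no two of its 4-cycles form a double-diamond. -/
def DAvoiding {V : Type*} [DecidableEq V] (C : Finset (Finset (Sym2 V))) : Prop :=
  ∀ E ∈ C, ∀ F ∈ C, ¬ IsDoubleDiamond E F

/-- `C` is strictly `r`-sparse: `r`-sparse and D-avoiding. -/
def StrictlyRSparse {V : Type*} [DecidableEq V] (r : ℕ)
    (C : Finset (Finset (Sym2 V))) : Prop :=
  RSparse r C ∧ DAvoiding C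


/-- `u v` is a diagonal of the 4-cycle `E`. -/
def DiagOf {V : Type*} [DecidableEq V] (E : Finset (Sym2 V)) (u v : V) : Prop :=
  ∃ b d : V, ([u, b, v, d] : List V).Nodup ∧ E = cycEdges u b v d

section comb
variable {V : Type*} [DecidableEq V]

lemma edgeVerts_cyc (a b c d : V) : edgeVerts (cycEdges a b c d) = {a, b, c, d} := by
  ext v
  simp [edgeVerts, cycEdges]
  tauto

lemma cyc_rot (a b c d : V) : cycEdges a b c d = cycEdges b c d a := by
  ext e; simp only [cycEdges, mem_insert, mem_singleton]; tauto

lemma cyc_refl (a b c d : V) : cycEdges a b c d = cycEdges a d c b := by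
  ext e
  simp only [cycEdges, mem_insert, mem_singleton]
  rw [Sym2.eq_swap (a := a) (b := b), Sym2.eq_swap (a := b) (b := c),
    Sym2.eq_swap (a := c) (b := d), Sym2.eq_swap (a := d) (b := a)]
  tauto

lemma edge_rep {E : Finset (Sym2 V)} (hE : IsFourCycle E) {u v : V} (h : s(u, v) ∈ E) :
    ∃ c d, ([u, v, c, d] : List V).Nodup ∧ E = cycEdges u v c d := by
  obtain ⟨a, b, c, d, hn, rfl⟩ := hE
  have hn' := hn
  simp at hn'
  simp only [cycEdges, mem_insert, mem_singleton, Sym2.eq_iff] at h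
  rcases h with (⟨rfl, rfl⟩ | ⟨rfl, rfl⟩) | (⟨rfl, rfl⟩ | ⟨rfl, rfl⟩) | (⟨rfl, rfl⟩ | ⟨rfl, rfl⟩) |
    (⟨rfl, rfl⟩ | ⟨rfl, rfl⟩)
  · exact ⟨c, d, hn, rfl⟩
  · exact ⟨d, c, by simp; tauto, by rw [cyc_refl, cyc_rot, cyc_rot, cyc_rot]⟩
  · exact ⟨d, a, by simp; tauto, by rw [cyc_rot]⟩
  · exact ⟨a, d, by simp; tauto, by rw [cyc_refl, cyc_rot, cyc_rot]⟩
  · exact ⟨a, b, by simp; tauto, by rw [cyc_rot, cyc_rot]⟩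
  · exact ⟨b, a, by simp; tauto, by rw [cyc_refl, cyc_rot]⟩
  · exact ⟨b, c, by simp; tauto, by rw [cyc_rot, cyc_rot, cyc_rot]⟩
  · exact ⟨c, b, by simp; tauto, by rw [cyc_refl]⟩

lemma cyc_card {E : Finset (Sym2 V)} (hE : IsFourCycle E) : (edgeVerts E).card = 4 := by
  obtain ⟨a, b, c, d, hn, rfl⟩ := hE
  rw [edgeVerts_cyc]
  simp at hn
  rw [card_insert_of_notMem, card_insert_of_notMem, card_insert_of_notMem] <;> simp <;> tauto

lemma edge_or_diag {E : Finset (Sym2 V)} (hE : IsFourCycle E) {u v : V} (hu : u ∈ edgeVerts E)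
    (hv : v ∈ edgeVerts E) (huv : u ≠ v) : s(u, v) ∈ E ∨ DiagOf E u v := by
  obtain ⟨a, b, c, d, hn, rfl⟩ := hE
  have hn' := hn
  simp at hn'
  rw [edgeVerts_cyc] at hu hv
  simp only [mem_insert, mem_singleton] at hu hv
  rcases hu with rfl | rfl | rfl | rfl <;> rcases hv with rfl | rfl | rfl | rfl <;>
    first
    | exact absurd rfl huv
    | (left; simp [cycEdges]; done)
    | skip
  · exact Or.inr ⟨b, d, hn, rfl⟩
  · exact Or.inr ⟨c, a, by simp; tauto, by rw [cyc_rot]⟩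
  · exact Or.inr ⟨d, b, by simp; tauto, by rw [cyc_rot, cyc_rot]⟩
  · exact Or.inr ⟨a, c, by simp; tauto, by rw [cyc_rot, cyc_rot, cyc_rot]⟩

lemma DiagOf.symm {E : Finset (Sym2 V)} {u v : V} (h : DiagOf E u v) : DiagOf E v u := by
  obtain ⟨b, d, hn, rfl⟩ := h
  simp at hn
  exact ⟨d, b, by simp; tauto, by rw [cyc_rot, cyc_rot]⟩

/-- A vertex adjacent to both ends of a diagonal. -/
lemma diag_edge {E : Finset (Sym2 V)} {u v z : V} (h : DiagOf E u v) (hz : z ∈ edgeVerts E)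
    (hu : z ≠ u) (hv : z ≠ v) : s(u, z) ∈ E ∧ s(v, z) ∈ E := by
  obtain ⟨b, d, hn, rfl⟩ := h
  rw [edgeVerts_cyc] at hz
  simp at hz
  rcases hz with rfl | rfl | rfl | rfl <;> simp_all [cycEdges]

lemma diag_mem {E : Finset (Sym2 V)} {u v : V} (h : DiagOf E u v) :
    u ∈ edgeVerts E ∧ v ∈ edgeVerts E ∧ u ≠ v := by
  obtain ⟨b, d, hn, rfl⟩ := h
  rw [edgeVerts_cyc]; simp at hn ⊢; tauto

lemma diag_not_edge {E : Finset (Sym2 V)} {u v : V} (h : DiagOf E u v) : s(u, v) ∉ E := by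
  obtain ⟨b, d, hn, rfl⟩ := h
  simp [cycEdges] at hn ⊢; grind

lemma edge_mem {E : Finset (Sym2 V)} (hE : IsFourCycle E) {u v : V} (h : s(u, v) ∈ E) :
    u ∈ edgeVerts E ∧ v ∈ edgeVerts E ∧ u ≠ v := by
  obtain ⟨c, d, hn, rfl⟩ := edge_rep hE h
  rw [edgeVerts_cyc]; simp at hn ⊢; tauto

/-- Two diagonals sharing a vertex coincide. -/
lemma diag_unique {E : Finset (Sym2 V)} {u v z : V} (h : DiagOf E u v) (h' : DiagOf E u z) :
    v = z := by
  by_contra hne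
  have h2 := diag_mem h'
  exact diag_not_edge h' (diag_edge h h2.2.1 (Ne.symm h2.2.2) (Ne.symm hne)).1

/-- The abstract conditions on the system. -/
structure Good (C : Finset (Finset (Sym2 V))) : Prop where
  cyc : ∀ E ∈ C, IsFourCycle E
  edge : ∀ E ∈ C, ∀ F ∈ C, ∀ e, e ∈ E → e ∈ F → E = F
  diag : ∀ E ∈ C, ∀ F ∈ C, ∀ u v, DiagOf E u v → DiagOf F u v → E = F
  opp : ∀ E ∈ C, ∀ F ∈ C, ∀ G ∈ C, ∀ a b c d, ([a, b, c, d] : List V).Nodup →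
    E = cycEdges a b c d → DiagOf F a b → DiagOf G c d → False

/-- An edge of `E` is a diagonal of `F`. -/
def Arc (E F : Finset (Sym2 V)) : Prop := ∃ u v, s(u, v) ∈ E ∧ DiagOf F u v

variable {C : Finset (Finset (Sym2 V))}

lemma Good.inter_le (hC : Good C) {E F : Finset (Sym2 V)} (hE : E ∈ C) (hF : F ∈ C)
    (hne : E ≠ F) : (edgeVerts E ∩ edgeVerts F).card ≤ 2 := by
  by_contra hcon
  obtain ⟨u, hu, v, hv, w, hw, huv, huw, hvw⟩ := Finset.two_lt_card.1 (not_le.1 hcon)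
  rw [mem_inter] at hu hv hw
  have tri : ∀ G ∈ C, u ∈ edgeVerts G → v ∈ edgeVerts G → w ∈ edgeVerts G →
      (s(u, v) ∈ G ∧ s(u, w) ∈ G) ∨ (s(u, v) ∈ G ∧ s(v, w) ∈ G) ∨
        (s(u, w) ∈ G ∧ s(v, w) ∈ G) := by
    intro G hG h1 h2 h3
    rcases edge_or_diag (hC.cyc G hG) h1 h2 huv with a | a
    · rcases edge_or_diag (hC.cyc G hG) h1 h3 huw with b | b
      · tauto
      · have := diag_edge b h2 huv.symm hvw
        rw [Sym2.eq_swap (a := w)] at this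
        tauto
    · have := diag_edge a h3 huw.symm hvw.symm
      tauto
  have h1 := tri E hE hu.1 hv.1 hw.1
  have h2 := tri F hF hu.2 hv.2 hw.2
  have k1 := hC.edge E hE F hF s(u, v)
  have k2 := hC.edge E hE F hF s(u, w)
  have k3 := hC.edge E hE F hF s(v, w)
  tauto

lemma Good.arc (hC : Good C) {E F : Finset (Sym2 V)} (hE : E ∈ C) (hF : F ∈ C)
    (hne : E ≠ F) (h2 : (edgeVerts E ∩ edgeVerts F).card = 2) : Arc E F ∨ Arc F E := by
  obtain ⟨u, v, huv, h⟩ := Finset.card_eq_two.1 h2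
  have hu : u ∈ edgeVerts E ∩ edgeVerts F := by rw [h]; simp
  have hv : v ∈ edgeVerts E ∩ edgeVerts F := by rw [h]; simp
  rw [mem_inter] at hu hv
  rcases edge_or_diag (hC.cyc E hE) hu.1 hv.1 huv with a | a
  · rcases edge_or_diag (hC.cyc F hF) hu.2 hv.2 huv with b | b
    · exact absurd (hC.edge E hE F hF _ a b) hne
    · exact Or.inl ⟨u, v, a, b⟩
  · rcases edge_or_diag (hC.cyc F hF) hu.2 hv.2 huv with b | b
    · exact Or.inr ⟨u, v, b, a⟩
    · exact absurd (hC.diag E hE F hF _ _ a b) hne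

/-- Two arcs out of `E` use edges meeting in a vertex. -/
lemma Good.out_two (hC : Good C) {E F G : Finset (Sym2 V)} (hE : E ∈ C) (hF : F ∈ C)
    (hG : G ∈ C) (hFG : F ≠ G) (h1 : Arc E F) (h2 : Arc E G) :
    ∃ u v w, u ≠ w ∧ s(v, u) ∈ E ∧ s(v, w) ∈ E ∧ DiagOf F v u ∧ DiagOf G v w := by
  obtain ⟨u, v, e1, d1⟩ := h1
  obtain ⟨u', v', e2, d2⟩ := h2
  obtain ⟨c, d, hn, hEq⟩ := edge_rep (hC.cyc E hE) e1
  have e1' := e1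
  have e2' := e2
  rw [Sym2.eq_swap] at e1' e2'
  have key : s(u', v') ∈ cycEdges u v c d := hEq ▸ e2
  simp only [cycEdges, mem_insert, mem_singleton, Sym2.eq_iff] at key
  have hn' := hn
  simp at hn'
  rcases key with (⟨rfl, rfl⟩ | ⟨rfl, rfl⟩) | (⟨rfl, rfl⟩ | ⟨rfl, rfl⟩) |
    (⟨rfl, rfl⟩ | ⟨rfl, rfl⟩) | (⟨rfl, rfl⟩ | ⟨rfl, rfl⟩)
  · exact absurd (hC.diag F hF G hG _ _ d1 d2) hFG
  · exact absurd (hC.diag F hF G hG _ _ d1 d2.symm) hFG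
  · exact ⟨u, u', v', by tauto, e1', e2, d1.symm, d2⟩
  · exact ⟨u, v', u', by tauto, e1', e2', d1.symm, d2.symm⟩
  · exact (hC.opp E hE F hF G hG u v u' v' hn hEq d1 d2).elim
  · exact (hC.opp E hE F hF G hG u v v' u' hn hEq d1 d2.symm).elim
  · exact ⟨v, v', u', by tauto, e1, e2', d1, d2.symm⟩
  · exact ⟨v, u', v', by tauto, e1, e2, d1, d2⟩

lemma Good.out_nonadj (hC : Good C) {E F G : Finset (Sym2 V)} (hE : E ∈ C) (hF : F ∈ C)
    (hG : G ∈ C) (hEF : E ≠ F) (hEG : E ≠ G) (hFG : F ≠ G) (h1 : Arc E F) (h2 : Arc E G) :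
    (edgeVerts F ∩ edgeVerts G).card ≠ 2 := by
  intro hcard
  obtain ⟨u, v, w, huw, e1, e2, d1, d2⟩ := hC.out_two hE hF hG hFG h1 h2
  have m1 := diag_mem d1
  have m2 := diag_mem d2
  obtain ⟨z, hz, hzv⟩ := Finset.exists_mem_ne (by omega : 1 < (edgeVerts F ∩ edgeVerts G).card) v
  rw [mem_inter] at hz
  have hu : z ≠ u := by
    rintro rfl
    rcases edge_or_diag (hC.cyc G hG) m2.1 hz.2 hzv.symm with a | a
    · exact hEG (hC.edge E hE G hG _ e1 a)
    · exact hFG (hC.diag F hF G hG _ _ d1 a)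
  have hw : z ≠ w := by
    rintro rfl
    rcases edge_or_diag (hC.cyc F hF) m1.1 hz.1 hzv.symm with a | a
    · exact hEF (hC.edge E hE F hF _ e2 a)
    · exact hFG (hC.diag F hF G hG _ _ a d2)
  exact hFG (hC.edge F hF G hG _ (diag_edge d1 hz.1 hzv hu).1 (diag_edge d2 hz.2 hzv hw).1)

lemma disj_diag (hC : Good C) {I J K : Finset (Sym2 V)} (hI : I ∈ C) (hJ : J ∈ C) (hK : K ∈ C)
    (hIJ : I ≠ J) (hIK : I ≠ K) (hJK : J ≠ K) (h1 : Arc J I) (h2 : Arc K I)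
    (cIJ : (edgeVerts I ∩ edgeVerts J).card = 2) (cIK : (edgeVerts I ∩ edgeVerts K).card = 2) :
    ∀ v, v ∈ edgeVerts I → v ∈ edgeVerts J → v ∈ edgeVerts K → False := by
  intro v hi hj hk
  obtain ⟨a, b, e1, d1⟩ := h1
  obtain ⟨a', b', e2, d2⟩ := h2
  have m1 := diag_mem d1
  have m2 := diag_mem d2
  have n1 := edge_mem (hC.cyc J hJ) e1
  have n2 := edge_mem (hC.cyc K hK) e2
  have s1 : edgeVerts I ∩ edgeVerts J = {a, b} := by
    symm
    apply Finset.eq_of_subset_of_card_le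
    · intro z; simp only [mem_insert, mem_singleton, mem_inter]; rintro (rfl | rfl) <;> tauto
    · rw [cIJ, Finset.card_pair m1.2.2]
  have s2 : edgeVerts I ∩ edgeVerts K = {a', b'} := by
    symm
    apply Finset.eq_of_subset_of_card_le
    · intro z; simp only [mem_insert, mem_singleton, mem_inter]; rintro (rfl | rfl) <;> tauto
    · rw [cIK, Finset.card_pair m2.2.2]
  have v1 : v ∈ ({a, b} : Finset V) := by rw [← s1]; simp [hi, hj]
  have v2 : v ∈ ({a', b'} : Finset V) := by rw [← s2]; simp [hi, hk]
  simp only [mem_insert, mem_singleton] at v1 v2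
  rcases v1 with rfl | rfl <;> rcases v2 with rfl | rfl
  · obtain rfl := diag_unique d1 d2
    exact hJK (hC.edge J hJ K hK _ e1 e2)
  · obtain rfl := diag_unique d1 d2.symm
    exact hJK (hC.edge J hJ K hK _ e1 (by rwa [Sym2.eq_swap]))
  · obtain rfl := diag_unique d1.symm d2
    exact hJK (hC.edge J hJ K hK _ e1 (by rwa [Sym2.eq_swap]))
  · obtain rfl := diag_unique d1.symm d2.symm
    exact hJK (hC.edge J hJ K hK _ e1 e2)

/-- The last case. -/
lemma final_case (hC : Good C) {L I J K : Finset (Sym2 V)} (hL : L ∈ C) (hI : I ∈ C) (hJ : J ∈ C)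
    (hK : K ∈ C) (hLI : L ≠ I) (hLJ : L ≠ J) (hLK : L ≠ K)
    (hIJ : I ≠ J) (hIK : I ≠ K) (hJK : J ≠ K)
    (lj : Arc L J) (lk : Arc L K) (ji : Arc J I) (ki : Arc K I)
    (cIJ : (edgeVerts I ∩ edgeVerts J).card = 2) (cIK : (edgeVerts I ∩ edgeVerts K).card = 2)
    (hu : (edgeVerts L ∪ edgeVerts I ∪ edgeVerts J ∪ edgeVerts K).card ≤ 7) : False := by
  have hd := disj_diag hC hI hJ hK hIJ hIK hJK ji ki cIJ cIK
  have cJK := hC.out_nonadj hL hJ hK hLJ hLK hJK lj lk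
  have cJK' := hC.inter_le hJ hK hJK
  obtain ⟨u, v, w, huw, e1, e2, d1, d2⟩ := hC.out_two hL hJ hK hJK lj lk
  have c4I := cyc_card (hC.cyc I hI)
  have c4J := cyc_card (hC.cyc J hJ)
  have c4K := cyc_card (hC.cyc K hK)
  have c4L := cyc_card (hC.cyc L hL)
  have cLJ := hC.inter_le hL hJ hLJ
  have cLK := hC.inter_le hL hK hLK
  have m1 := diag_mem d1
  have m2 := diag_mem d2
  have n1 := edge_mem (hC.cyc L hL) e1
  generalize edgeVerts I = i at *
  generalize edgeVerts J = j at *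
  generalize edgeVerts K = k at *
  generalize edgeVerts L = l at *
  have hi : i ⊆ j ∪ k := by
    have : (i ∩ j) ∪ (i ∩ k) = i := by
      apply Finset.eq_of_subset_of_card_le
      · intro z; simp; tauto
      · rw [card_union_of_disjoint, cIJ, cIK, c4I]
        rw [Finset.disjoint_left]; intro z; simp only [mem_inter]
        intro a b; exact hd z a.1 a.2 b.2
    intro z hz
    rw [← this] at hz
    simp at hz ⊢; tauto
  have c1 := card_union_add_card_inter j k
  have hl : l ⊆ j ∪ k := by
    have : j ∪ k = l ∪ i ∪ j ∪ k := by
      apply Finset.eq_of_subset_of_card_le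
      · intro z; simp; tauto
      · omega
    rw [this]; intro z hz; simp [hz]
  have : l ⊆ (l ∩ j) ∪ (l ∩ k) := by
    intro z hz; have := hl hz; simp at this ⊢; tauto
  have c2 := card_le_card this
  have c3 := card_union_add_card_inter (l ∩ j) (l ∩ k)
  have c5 : 0 < ((l ∩ j) ∩ (l ∩ k)).card := Finset.card_pos.2 ⟨v, by simp; tauto⟩
  omega

lemma quad_case (hC : Good C) {L I J K : Finset (Sym2 V)} (hL : L ∈ C) (hI : I ∈ C) (hJ : J ∈ C)
    (hK : K ∈ C) (hLI : L ≠ I) (hLJ : L ≠ J) (hLK : L ≠ K)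
    (hIJ : I ≠ J) (hIK : I ≠ K) (hJK : J ≠ K)
    (cLI : (edgeVerts L ∩ edgeVerts I).card = 2)
    (cLJ : (edgeVerts L ∩ edgeVerts J).card = 2) (cLK : (edgeVerts L ∩ edgeVerts K).card = 2)
    (cIJ : (edgeVerts I ∩ edgeVerts J).card = 2) (cIK : (edgeVerts I ∩ edgeVerts K).card = 2)
    (hu : (edgeVerts L ∪ edgeVerts I ∪ edgeVerts J ∪ edgeVerts K).card ≤ 7) : False := by
  have f1 := fun a b c d => final_case hC hL hI hJ hK hLI hLJ hLK hIJ hIK hJK a b c d cIJ cIK hu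
  rw [union_comm (edgeVerts L) (edgeVerts I)] at hu
  have f2 := fun a b c d =>
    final_case hC hI hL hJ hK hLI.symm hIJ hIK hLJ hLK hJK a b c d cLJ cLK hu
  have a1 := hC.arc hL hI hLI cLI
  have a2 := hC.arc hL hJ hLJ cLJ
  have a3 := hC.arc hL hK hLK cLK
  have a4 := hC.arc hI hJ hIJ cIJ
  have a5 := hC.arc hI hK hIK cIK
  have b1 := fun a b => hC.out_nonadj hL hI hJ hLI hLJ hIJ a b cIJ
  have b2 := fun a b => hC.out_nonadj hL hI hK hLI hLK hIK a b cIK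
  have b3 := fun a b => hC.out_nonadj hI hL hJ hLI.symm hIJ hLJ a b cLJ
  have b4 := fun a b => hC.out_nonadj hI hL hK hLI.symm hIK hLK a b cLK
  have b5 := fun a b => hC.out_nonadj hJ hL hI hLJ.symm hIJ.symm hLI a b cLI
  have b6 := fun a b => hC.out_nonadj hK hL hI hLK.symm hIK.symm hLI a b cLI
  clear hu cLI cLJ cLK cIJ cIK
  grind

lemma sum_inter (a b c d : Finset V) :
    2 * (a.card + b.card + c.card + d.card) ≤ 3 * (a ∪ b ∪ c ∪ d).card +
      ((a ∩ b).card + (a ∩ c).card + (a ∩ d).card + (b ∩ c).card + (b ∩ d).card +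
        (c ∩ d).card) := by
  set U := a ∪ b ∪ c ∪ d with hU
  have key : ∀ s : Finset V, s ⊆ U → s.card = ∑ v ∈ U, if v ∈ s then 1 else 0 := by
    intro s hs
    rw [← Finset.sum_filter, ← Finset.card_eq_sum_ones, Finset.filter_mem_eq_inter,
      Finset.inter_eq_right.2 hs]
  have ha : a ⊆ U := by intro z; simp [hU]; tauto
  have hb : b ⊆ U := by intro z; simp [hU]; tauto
  have hc : c ⊆ U := by intro z; simp [hU]; tauto
  have hd : d ⊆ U := by intro z; simp [hU]; tauto
  rw [key a ha, key b hb, key c hc, key d hd, key (a ∩ b) (inter_subset_left.trans ha),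
    key (a ∩ c) (inter_subset_left.trans ha), key (a ∩ d) (inter_subset_left.trans ha),
    key (b ∩ c) (inter_subset_left.trans hb), key (b ∩ d) (inter_subset_left.trans hb),
    key (c ∩ d) (inter_subset_left.trans hc), Finset.card_eq_sum_ones U]
  simp only [← Finset.sum_add_distrib, Finset.mul_sum]
  apply Finset.sum_le_sum
  intro v _
  simp only [mem_inter]
  by_cases h1 : v ∈ a <;> by_cases h2 : v ∈ b <;> by_cases h3 : v ∈ c <;> by_cases h4 : v ∈ d <;>
    simp [h1, h2, h3, h4]

lemma four_case (hC : Good C) {A B D E : Finset (Sym2 V)} (hA : A ∈ C) (hB : B ∈ C) (hD : D ∈ C)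
    (hE : E ∈ C) (hAB : A ≠ B) (hAD : A ≠ D) (hAE : A ≠ E) (hBD : B ≠ D) (hBE : B ≠ E)
    (hDE : D ≠ E)
    (hu : (edgeVerts A ∪ edgeVerts B ∪ edgeVerts D ∪ edgeVerts E).card ≤ 7) : False := by
  have s := sum_inter (edgeVerts A) (edgeVerts B) (edgeVerts D) (edgeVerts E)
  rw [cyc_card (hC.cyc A hA), cyc_card (hC.cyc B hB), cyc_card (hC.cyc D hD),
    cyc_card (hC.cyc E hE)] at s
  have c1 := hC.inter_le hA hB hAB
  have c2 := hC.inter_le hA hD hAD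
  have c3 := hC.inter_le hA hE hAE
  have c4 := hC.inter_le hB hD hBD
  have c5 := hC.inter_le hB hE hBE
  have c6 := hC.inter_le hD hE hDE
  have perm : ∀ X : Finset V, X = edgeVerts A ∪ edgeVerts B ∪ edgeVerts D ∪ edgeVerts E →
    X.card ≤ 7 := by rintro X rfl; exact hu
  have cm : ∀ X Y : Finset V, (X ∩ Y).card = (Y ∩ X).card := fun X Y => by rw [inter_comm]
  by_cases h1 : (edgeVerts A ∩ edgeVerts B).card = 2
  swap
  · refine quad_case hC hD hE hA hB hDE hAD.symm hBD.symm hAE.symm hBE.symm hAB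
      ?_ ?_ ?_ ?_ ?_ (perm _ (by ext; simp; tauto)) <;> first | omega | (rw [cm]; omega)
  by_cases h2 : (edgeVerts A ∩ edgeVerts D).card = 2
  swap
  · refine quad_case hC hB hE hA hD hBE hAB.symm hBD hAE.symm hDE.symm hAD
      ?_ ?_ ?_ ?_ ?_ (perm _ (by ext; simp; tauto)) <;> first | omega | (rw [cm]; omega)
  by_cases h3 : (edgeVerts A ∩ edgeVerts E).card = 2
  swap
  · refine quad_case hC hB hD hA hE hBD hAB.symm hBE hAD.symm hDE hAE
      ?_ ?_ ?_ ?_ ?_ (perm _ (by ext; simp; tauto)) <;> first | omega | (rw [cm]; omega)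
  by_cases h4 : (edgeVerts B ∩ edgeVerts D).card = 2
  swap
  · refine quad_case hC hA hE hB hD hAE hAB hAD hBE.symm hDE.symm hBD
      ?_ ?_ ?_ ?_ ?_ (perm _ (by ext; simp; tauto)) <;> first | omega | (rw [cm]; omega)
  by_cases h5 : (edgeVerts B ∩ edgeVerts E).card = 2
  swap
  · refine quad_case hC hA hD hB hE hAD hAB hAE hBD.symm hDE hBE
      ?_ ?_ ?_ ?_ ?_ (perm _ (by ext; simp; tauto)) <;> first | omega | (rw [cm]; omega)
  exact quad_case hC hA hB hD hE hAB hAD hAE hBD hBE hDE h1 h2 h3 h4 h5 hu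

lemma three_case (hC : Good C) {A B D : Finset (Sym2 V)} (hA : A ∈ C) (hB : B ∈ C) (hD : D ∈ C)
    (hAB : A ≠ B) (hAD : A ≠ D) (hBD : B ≠ D)
    (hu : (edgeVerts A ∪ edgeVerts B ∪ edgeVerts D).card ≤ 6) : False := by
  have c1 := hC.inter_le hA hB hAB
  have c2 := hC.inter_le hA hD hAD
  have c4 := hC.inter_le hB hD hBD
  have s := sum_inter (edgeVerts A) (edgeVerts B) (edgeVerts D) ∅
  rw [cyc_card (hC.cyc A hA), cyc_card (hC.cyc B hB), cyc_card (hC.cyc D hD)] at s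
  simp at s
  rw [← union_assoc] at s
  have key : ∀ I ∈ C, ∀ J ∈ C, ∀ K ∈ C, I ≠ J → I ≠ K → J ≠ K → Arc I J → Arc K I →
      (edgeVerts I ∩ edgeVerts J).card = 2 → (edgeVerts I ∩ edgeVerts K).card = 2 →
      (edgeVerts J ∩ edgeVerts K).card = 2 →
      (edgeVerts I ∪ edgeVerts J ∪ edgeVerts K).card ≤ 6 → False := by
    rintro I hI J hJ K hK hIJ hIK hJK ⟨u, v, e, d⟩ ⟨u', v', e', d'⟩ cIJ cIK cJK hc
    have c4I := cyc_card (hC.cyc I hI)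
    have c4J := cyc_card (hC.cyc J hJ)
    have c4K := cyc_card (hC.cyc K hK)
    have m1 := diag_mem d
    have m2 := diag_mem d'
    have n1 := edge_mem (hC.cyc I hI) e
    have n2 := edge_mem (hC.cyc K hK) e'
    have hsub : edgeVerts I ⊆ edgeVerts J ∪ edgeVerts K := by
      have c1 := card_union_add_card_inter (edgeVerts J) (edgeVerts K)
      have : edgeVerts J ∪ edgeVerts K = edgeVerts I ∪ edgeVerts J ∪ edgeVerts K := by
        apply Finset.eq_of_subset_of_card_le
        · intro z; simp; tauto
        · omega
      rw [this]; intro z hz; simp [hz]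
    have hsub' : edgeVerts I ⊆ {u, v} ∪ {u', v'} := by
      have s1 : edgeVerts I ∩ edgeVerts J = {u, v} := by
        symm
        apply Finset.eq_of_subset_of_card_le
        · intro z; simp only [mem_insert, mem_singleton, mem_inter]; rintro (rfl | rfl) <;> tauto
        · rw [cIJ, Finset.card_pair m1.2.2]
      have s2 : edgeVerts I ∩ edgeVerts K = {u', v'} := by
        symm
        apply Finset.eq_of_subset_of_card_le
        · intro z; simp only [mem_insert, mem_singleton, mem_inter]; rintro (rfl | rfl) <;> tauto
        · rw [cIK, Finset.card_pair m2.2.2]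
      rw [← s1, ← s2]
      intro z hz
      have := hsub hz
      simp at this ⊢; tauto
    obtain ⟨b, d0, hn, hEq⟩ := d'
    rw [hEq, edgeVerts_cyc] at hsub'
    have h1 := @hsub' b (by simp)
    have h2 := @hsub' d0 (by simp)
    rw [hEq] at e
    simp [cycEdges] at hn h1 h2 e
    grind
  have a1 := hC.arc hA hB hAB (by omega)
  have a2 := hC.arc hA hD hAD (by omega)
  have a3 := hC.arc hB hD hBD (by omega)
  have h1 : (edgeVerts A ∩ edgeVerts B).card = 2 := by omega
  have h2 : (edgeVerts A ∩ edgeVerts D).card = 2 := by omega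
  have h3 : (edgeVerts B ∩ edgeVerts D).card = 2 := by omega
  have b1 := fun a b => hC.out_nonadj hA hB hD hAB hAD hBD a b h3
  have b2 := fun a b => hC.out_nonadj hB hA hD hAB.symm hBD hAD a b h2
  have b3 := fun a b => hC.out_nonadj hD hA hB hAD.symm hBD.symm hAB a b h1
  have k1 := fun a b => key A hA B hB D hD hAB hAD hBD a b h1 h2 h3 hu
  have k2 := fun a b => key A hA D hD B hB hAD hAB hBD.symm a b h2 h1 (by rwa [inter_comm])
    (by rwa [union_right_comm])
  clear hu c1 c2 c4 s h1 h2 h3 key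
  grind

lemma Good.strict (hC : Good C) : StrictlyRSparse 4 C := by
  constructor
  · rintro j h2 h4 D hD ⟨hcard, -, -, hk⟩
    interval_cases j
    · obtain ⟨A, B, hAB, rfl⟩ := Finset.card_eq_two.1 hcard
      simp at hk
      have hA : A ∈ C := hD (by simp)
      have hB : B ∈ C := hD (by simp)
      have := hC.inter_le hA hB hAB
      have c1 := card_union_add_card_inter (edgeVerts A) (edgeVerts B)
      rw [cyc_card (hC.cyc A hA), cyc_card (hC.cyc B hB)] at c1
      omega
    · obtain ⟨A, B, E, hAB, hAE, hBE, rfl⟩ := Finset.card_eq_three.1 hcard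
      simp at hk
      exact three_case hC (hD (by simp)) (hD (by simp)) (hD (by simp)) hAB hAE hBE
        (by rw [union_assoc]; omega)
    · obtain ⟨A, D', hA, rfl, hc⟩ := Finset.card_eq_succ.1 hcard
      obtain ⟨B, E, F, hAB, hAE, hBE, rfl⟩ := Finset.card_eq_three.1 hc
      simp at hk hA
      exact four_case hC (hD (by simp)) (hD (by simp)) (hD (by simp)) (hD (by simp)) hA.1 hA.2.1
        hA.2.2 hAB hAE hBE (by rw [union_assoc, union_assoc]; omega)
  · rintro E hE F hF ⟨a, b, c, d, e, f, hn, hE', hF'⟩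
    have : E = F := hC.diag E hE F hF a c ⟨b, d, by simp at hn ⊢; tauto, hE'⟩
      ⟨e, f, by simp at hn ⊢; tauto, hF'⟩
    have hb : b ∈ edgeVerts F := by rw [← this, hE', edgeVerts_cyc]; simp
    rw [hF', edgeVerts_cyc] at hb
    simp at hn hb; tauto

end comb

section comb2
variable {V : Type*} [DecidableEq V]

lemma diag_cyc {a b c d u v : V} (hn : ([a, b, c, d] : List V).Nodup)
    (h : DiagOf (cycEdges a b c d) u v) :
    (u = a ∧ v = c) ∨ (u = c ∧ v = a) ∨ (u = b ∧ v = d) ∨ (u = d ∧ v = b) := by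
  have h1 := diag_mem h
  have h2 := diag_not_edge h
  rw [edgeVerts_cyc] at h1
  simp [cycEdges] at hn h1 h2
  grind

lemma opp_cyc {a b c d a' b' c' d' : V} (hn : ([a, b, c, d] : List V).Nodup)
    (hn' : ([a', b', c', d'] : List V).Nodup) (h : cycEdges a b c d = cycEdges a' b' c' d') :
    (s(a, b) = s(a', b') ∧ s(c, d) = s(c', d')) ∨ (s(a, b) = s(c', d') ∧ s(c, d) = s(a', b')) ∨
    (s(a, b) = s(b', c') ∧ s(c, d) = s(d', a')) ∨ (s(a, b) = s(d', a') ∧ s(c, d) = s(b', c')) := by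
  have h1 : s(a, b) ∈ cycEdges a' b' c' d' := by rw [← h]; simp [cycEdges]
  have h2 : s(c, d) ∈ cycEdges a' b' c' d' := by rw [← h]; simp [cycEdges]
  simp [cycEdges] at hn hn' h1 h2 ⊢
  grind

end comb2

section construct
variable {F V : Type*} [Field F] [DecidableEq V]

/-- The 4-cycle with scale `s` and translation `t`. -/
def cycOf (π : F ≃ V) (w y s t : F) : Finset (Sym2 V) :=
  cycEdges (π t) (π (t + s)) (π (t + s * (1 - w))) (π (t + s * (w * y)))

/-- The algebraic data of the construction; `S` is the set of scales. -/
structure Data (x y w : F) (S : F → Prop) : Prop where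
  rel : w * (1 + y) = 1 + x
  two : (2 : F) ≠ 0
  x0 : x ≠ 0
  y0 : y ≠ 0
  w0 : w ≠ 0
  sqx : IsSquare x
  sqy : IsSquare y
  neg : IsSquare (-1 : F)
  nw : ¬ IsSquare w
  nD : ¬ IsSquare ((1 - w) * (1 - w * y))
  s0 : ∀ s, S s → s ≠ 0
  sq : ∀ s, S s → IsSquare s
  u1 : ∀ s s', S s → S s' → s ^ 2 = s' ^ 2 → s = s'
  ux : ∀ s s', S s → S s' → s ^ 2 ≠ (x * s') ^ 2
  uy : ∀ s s', S s → S s' → s ^ 2 ≠ (y * s') ^ 2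
  ex : ∀ e, e ≠ 0 → IsSquare e → ∃ s, S s ∧ (e = s ∨ e = -s ∨ e = x * s ∨ e = -(x * s))
  ey : ∀ e, e ≠ 0 → IsSquare e → ∃ s, S s ∧ (e = s ∨ e = -s ∨ e = y * s ∨ e = -(y * s))
  ns : ∀ e, ¬ IsSquare e → IsSquare (e / w)

variable {x y w : F} {S : F → Prop}

lemma isSquare_of_sq_eq (hneg : IsSquare (-1 : F)) {a b : F} (h : a ^ 2 = b ^ 2)
    (hb : IsSquare b) : IsSquare a := by
  rcases sq_eq_sq_iff_eq_or_eq_neg.1 h with rfl | rfl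
  · exact hb
  · rw [neg_eq_neg_one_mul]; exact hneg.mul hb

lemma isSquare_of_mul {a b : F} (hb : IsSquare b) (hb0 : b ≠ 0) (h : IsSquare (a * b)) :
    IsSquare a := by
  have := h.div hb
  rwa [mul_div_assoc, div_self hb0, mul_one] at this

lemma Data.pw (H : Data x y w S) {a b : F} (ha : IsSquare a) (hb : IsSquare b) (hb0 : b ≠ 0) :
    a ^ 2 ≠ (w * b) ^ 2 := fun h =>
  H.nw (isSquare_of_mul hb hb0 (isSquare_of_sq_eq H.neg h.symm ha))

lemma Data.D0 (H : Data x y w S) : (1 - w) ≠ 0 ∧ (1 - w * y) ≠ 0 := by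
  constructor <;> intro h <;> apply H.nD <;> rw [h] <;> simp

/-- Values of square multiples of the two diagonals cannot agree up to sign. -/
lemma Data.pD (H : Data x y w S) {a b : F} (hab : IsSquare (a * b)) (ha0 : a ≠ 0) (hb0 : b ≠ 0) :
    (a * (1 - w)) ^ 2 ≠ (b * (1 - w * y)) ^ 2 := fun h => by
  apply H.nD
  apply isSquare_of_mul hab (mul_ne_zero ha0 hb0)
  apply isSquare_of_sq_eq H.neg (b := (b * (1 - w * y)) * (b * (1 - w * y)))
  · linear_combination (b * (1 - w * y)) ^ 2 * h
  · exact ⟨_, rfl⟩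

lemma Data.nodup (H : Data x y w S) (π : F ≃ V) {s t : F} (hs : S s) :
    ([π t, π (t + s), π (t + s * (1 - w)), π (t + s * (w * y))] : List V).Nodup := by
  have h0 := H.s0 s hs
  have ⟨h1, h2⟩ := H.D0
  have h3 := H.w0
  have h4 := H.x0
  have h5 := H.y0
  have h6 : s * (1 - w) ≠ 0 := mul_ne_zero h0 h1
  have h7 : s * (1 - w * y) ≠ 0 := mul_ne_zero h0 h2
  have h8 : s * w ≠ 0 := mul_ne_zero h0 h3
  have h9 : s * x ≠ 0 := mul_ne_zero h0 h4
  have h10 : s * w * y ≠ 0 := mul_ne_zero h8 h5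
  have hr := H.rel
  simp only [List.nodup_cons, List.mem_cons, List.not_mem_nil, EmbeddingLike.apply_eq_iff_eq,
    or_false, not_or, not_false_eq_true, List.nodup_nil, and_true]
  refine ⟨⟨fun h => h0 ?_, fun h => h6 ?_, fun h => h10 ?_⟩, ⟨fun h => h8 ?_, fun h => h7 ?_⟩,
    fun h => h9 ?_⟩
  · linear_combination -h
  · linear_combination -h
  · linear_combination -h
  · linear_combination h
  · linear_combination h
  · linear_combination -h - s * hr

/-- Description of the edges of a cycle. -/
lemma Data.edge_desc (H : Data x y w S) (π : F ≃ V) {s t a b : F}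
    (h : s(π a, π b) ∈ cycOf π w y s t) :
    ((b - a = s ∧ t = a) ∨ (a - b = s ∧ t = b)) ∨
    ((b - a = -(w * s) ∧ t = a - s) ∨ (a - b = -(w * s) ∧ t = b - s)) ∨
    ((b - a = x * s ∧ t = a - s * (1 - w)) ∨ (a - b = x * s ∧ t = b - s * (1 - w))) ∨
    ((b - a = -(w * (y * s)) ∧ t = b) ∨ (a - b = -(w * (y * s)) ∧ t = a)) := by
  have hr := H.rel
  simp only [cycOf, cycEdges, mem_insert, mem_singleton, Sym2.eq_iff,
    EmbeddingLike.apply_eq_iff_eq] at h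
  rcases h with (⟨rfl, rfl⟩ | ⟨rfl, rfl⟩) | (⟨rfl, rfl⟩ | ⟨rfl, rfl⟩) | (⟨rfl, rfl⟩ | ⟨rfl, rfl⟩) |
    (⟨rfl, rfl⟩ | ⟨rfl, rfl⟩)
  · left; left; constructor <;> ring
  · left; right; constructor <;> ring
  · right; left; left; constructor <;> ring
  · right; left; right; constructor <;> ring
  · right; right; left; left; constructor
    · linear_combination s * hr
    · ring
  · right; right; left; right; constructor
    · linear_combination s * hr
    · ring
  · right; right; right; left; constructor <;> ring
  · right; right; right; right; constructor <;> ring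

set_option maxHeartbeats 1000000 in
lemma Data.edge_unique (H : Data x y w S) (π : F ≃ V) {s t s' t' a b : F} (hs : S s) (hs' : S s')
    (h : s(π a, π b) ∈ cycOf π w y s t) (h' : s(π a, π b) ∈ cycOf π w y s' t') :
    s = s' ∧ t = t' := by
  have opp : ∀ δ : F, δ ≠ 0 → ∀ e f : F, b - a = e → a - b = f → e = δ * s → f = δ * s → False := by
    intro δ hδ e f h1 h2 h3 h4
    apply mul_ne_zero H.two (mul_ne_zero hδ (H.s0 s hs))
    linear_combination -h1 - h2 - h3 - h4
  have q1 := H.sq s hs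
  have q2 := H.sq s' hs'
  have z1 := H.s0 s hs
  have z2 := H.s0 s' hs'
  have u1 := H.u1 s s' hs hs'
  have ux := H.ux s s' hs hs'
  have ux' := H.ux s' s hs' hs
  have uy := H.uy s s' hs hs'
  have uy' := H.uy s' s hs' hs
  have x0 := H.x0
  have y0 := H.y0
  have w0 := H.w0
  have g := H.edge_desc π h
  have g' := H.edge_desc π h'
  have sq1 : ∀ {e : F}, (b - a = e ∨ a - b = e) → (b - a) ^ 2 = e ^ 2 := by
    rintro e (h | h) <;> rw [← h]; ring
  have cx : ∀ {c : F}, c ≠ 0 → (c * s) ^ 2 = (c * s') ^ 2 → s = s' := by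
    intro c hc hh
    apply u1
    rw [mul_pow, mul_pow] at hh
    exact mul_left_cancel₀ (pow_ne_zero 2 hc) hh
  have par1 := H.pw q1 q2 z2
  have par2 := H.pw q1 (H.sqy.mul q2) (mul_ne_zero y0 z2)
  have par3 := H.pw (H.sqx.mul q1) q2 z2
  have par4 := H.pw (H.sqx.mul q1) (H.sqy.mul q2) (mul_ne_zero y0 z2)
  have par1' := H.pw q2 q1 z1
  have par2' := H.pw q2 (H.sqy.mul q1) (mul_ne_zero y0 z1)
  have par3' := H.pw (H.sqx.mul q2) q1 z1
  have par4' := H.pw (H.sqx.mul q2) (H.sqy.mul q1) (mul_ne_zero y0 z1)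
  have yy : (w * s) ^ 2 ≠ (w * (y * s')) ^ 2 := fun hh => uy (by
    rw [mul_pow, mul_pow w] at hh; exact mul_left_cancel₀ (pow_ne_zero 2 w0) hh)
  have yy' : (w * s') ^ 2 ≠ (w * (y * s)) ^ 2 := fun hh => uy' (by
    rw [mul_pow, mul_pow w] at hh; exact mul_left_cancel₀ (pow_ne_zero 2 w0) hh)
  have fin : ∀ {δ e f : F}, δ ≠ 0 → e = δ * s → b - a = e → a - b = e → False := by
    intro δ e f hδ he h1 h2
    exact opp δ hδ e e h1 h2 he he
  have key : s = s' := by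
    have k : ((b - a) ^ 2 = s ^ 2 ∨ (b - a) ^ 2 = (w * s) ^ 2 ∨ (b - a) ^ 2 = (x * s) ^ 2 ∨
        (b - a) ^ 2 = (w * (y * s)) ^ 2) := by
      rcases g with g | g | g | g
      · exact Or.inl (sq1 (g.imp And.left And.left))
      · exact Or.inr (Or.inl (by rw [← neg_sq (w * s)]; exact sq1 (g.imp And.left And.left)))
      · exact Or.inr (Or.inr (Or.inl (sq1 (g.imp And.left And.left))))
      · exact Or.inr (Or.inr (Or.inr (by rw [← neg_sq (w * (y * s))]; exact sq1 (g.imp And.left And.left))))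
    have k' : ((b - a) ^ 2 = s' ^ 2 ∨ (b - a) ^ 2 = (w * s') ^ 2 ∨ (b - a) ^ 2 = (x * s') ^ 2 ∨
        (b - a) ^ 2 = (w * (y * s')) ^ 2) := by
      rcases g' with g | g | g | g
      · exact Or.inl (sq1 (g.imp And.left And.left))
      · exact Or.inr (Or.inl (by rw [← neg_sq (w * s')]; exact sq1 (g.imp And.left And.left)))
      · exact Or.inr (Or.inr (Or.inl (sq1 (g.imp And.left And.left))))
      · exact Or.inr (Or.inr (Or.inr (by rw [← neg_sq (w * (y * s'))]; exact sq1 (g.imp And.left And.left))))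
    rcases k with k | k | k | k <;> rcases k' with k' | k' | k' | k' <;> have k2 := k.symm.trans k'
    · exact u1 k2
    · exact absurd k2 par1
    · exact absurd k2 ux
    · exact absurd k2 par2
    · exact absurd k2.symm par1'
    · exact cx w0 k2
    · exact absurd k2.symm par3'
    · exact absurd k2 yy
    · exact absurd k2.symm ux'
    · exact absurd k2 par3
    · exact cx x0 k2
    · exact absurd k2 par4
    · exact absurd k2.symm par2'
    · exact absurd k2.symm yy'
    · exact absurd k2.symm par4'
    · rw [← mul_assoc, ← mul_assoc] at k2
      exact cx (mul_ne_zero w0 y0) k2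
  subst key
  refine ⟨rfl, ?_⟩
  have k1 : s ^ 2 ≠ (w * s) ^ 2 := par1
  have two := H.two
  have nn : ∀ {e : F}, e ≠ 0 → b - a = e → a - b = e → False := by
    intro e he h1 h2
    apply mul_ne_zero H.two he
    linear_combination -h1 - h2
  have e1 : s ≠ 0 := z1
  have e2 : -(w * s) ≠ 0 := neg_ne_zero.2 (mul_ne_zero w0 z1)
  have e3 : x * s ≠ 0 := mul_ne_zero x0 z1
  have e4 : -(w * (y * s)) ≠ 0 := neg_ne_zero.2 (mul_ne_zero w0 (mul_ne_zero y0 z1))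
  have bad : ∀ {e f : F}, e ^ 2 ≠ f ^ 2 → (b - a = e ∨ a - b = e) → (b - a = f ∨ a - b = f) →
      False := fun hne h1 h2 => hne ((sq1 h1).symm.trans (sq1 h2))
  have b12 : s ^ 2 ≠ (-(w * s)) ^ 2 := by rw [neg_sq]; exact par1
  have b13 := ux
  have b14 : s ^ 2 ≠ (-(w * (y * s))) ^ 2 := by rw [neg_sq]; exact par2
  have b23 : (x * s) ^ 2 ≠ (-(w * s)) ^ 2 := by rw [neg_sq]; exact par3
  have b24 : (-(w * s)) ^ 2 ≠ (-(w * (y * s))) ^ 2 := by rw [neg_sq, neg_sq]; exact yy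
  have b34 : (x * s) ^ 2 ≠ (-(w * (y * s))) ^ 2 := by rw [neg_sq]; exact par4
  rcases g with g | g | g | g <;> rcases g' with g' | g' | g' | g'
  · rcases g with g | g <;> rcases g' with g' | g'
    · rw [g.2, g'.2]
    · exact (nn e1 g.1 g'.1).elim
    · exact (nn e1 g'.1 g.1).elim
    · rw [g.2, g'.2]
  · exact (bad b12 (g.imp And.left And.left) (g'.imp And.left And.left)).elim
  · exact (bad b13 (g.imp And.left And.left) (g'.imp And.left And.left)).elim
  · exact (bad b14 (g.imp And.left And.left) (g'.imp And.left And.left)).elim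
  · exact (bad b12 (g'.imp And.left And.left) (g.imp And.left And.left)).elim
  · rcases g with g | g <;> rcases g' with g' | g'
    · rw [g.2, g'.2]
    · exact (nn e2 g.1 g'.1).elim
    · exact (nn e2 g'.1 g.1).elim
    · rw [g.2, g'.2]
  · exact (bad b23 (g'.imp And.left And.left) (g.imp And.left And.left)).elim
  · exact (bad b24 (g.imp And.left And.left) (g'.imp And.left And.left)).elim
  · exact (bad b13 (g'.imp And.left And.left) (g.imp And.left And.left)).elim
  · exact (bad b23 (g.imp And.left And.left) (g'.imp And.left And.left)).elim
  · rcases g with g | g <;> rcases g' with g' | g'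
    · rw [g.2, g'.2]
    · exact (nn e3 g.1 g'.1).elim
    · exact (nn e3 g'.1 g.1).elim
    · rw [g.2, g'.2]
  · exact (bad b34 (g.imp And.left And.left) (g'.imp And.left And.left)).elim
  · exact (bad b14 (g'.imp And.left And.left) (g.imp And.left And.left)).elim
  · exact (bad b24 (g'.imp And.left And.left) (g.imp And.left And.left)).elim
  · exact (bad b34 (g'.imp And.left And.left) (g.imp And.left And.left)).elim
  · rcases g with g | g <;> rcases g' with g' | g'
    · rw [g.2, g'.2]
    · exact (nn e4 g.1 g'.1).elim
    · exact (nn e4 g'.1 g.1).elim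
    · rw [g.2, g'.2]

lemma Data.edge_exists (H : Data x y w S) (π : F ≃ V) {a b : F} (hab : a ≠ b) :
    ∃ s t, S s ∧ s(π a, π b) ∈ cycOf π w y s t := by
  have he : b - a ≠ 0 := sub_ne_zero.2 hab.symm
  have hr := H.rel
  have mk0 : ∀ a b s : F, b = a + s → s(π a, π b) ∈ cycOf π w y s a := by
    rintro a b s rfl; simp [cycOf, cycEdges]
  have mk1 : ∀ a b s : F, b - a = -(w * s) → s(π a, π b) ∈ cycOf π w y s (a - s) := by
    intro a b s h
    have h1 : a - s + s = a := by ring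
    have h2 : a - s + s * (1 - w) = b := by linear_combination -h
    unfold cycOf; rw [h1, h2]; simp [cycEdges]
  have mk2 : ∀ a b s : F, b - a = x * s → s(π a, π b) ∈ cycOf π w y s (a - s * (1 - w)) := by
    intro a b s h
    have h1 : a - s * (1 - w) + s * (1 - w) = a := by ring
    have h2 : a - s * (1 - w) + s * (w * y) = b := by linear_combination -h + s * hr
    unfold cycOf; rw [h1, h2]; simp [cycEdges]
  have mk3 : ∀ a b s : F, b - a = -(w * (y * s)) → s(π a, π b) ∈ cycOf π w y s b := by
    intro a b s h
    have h1 : b + s * (w * y) = a := by linear_combination h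
    unfold cycOf; rw [h1]; simp [cycEdges]
  by_cases hsq : IsSquare (b - a)
  · obtain ⟨s, hs, h | h | h | h⟩ := H.ex _ he hsq
    · exact ⟨s, a, hs, mk0 a b s (by linear_combination h)⟩
    · exact ⟨s, b, hs, by rw [Sym2.eq_swap]; exact mk0 b a s (by linear_combination -h)⟩
    · exact ⟨s, _, hs, mk2 a b s h⟩
    · exact ⟨s, _, hs, by rw [Sym2.eq_swap]; exact mk2 b a s (by linear_combination -h)⟩
  · obtain ⟨s, hs, h⟩ := H.ey _ (div_ne_zero he H.w0) (H.ns _ hsq)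
    simp only [div_eq_iff H.w0] at h
    rcases h with h | h | h | h
    · exact ⟨s, _, hs, by rw [Sym2.eq_swap]; exact mk1 b a s (by linear_combination -h)⟩
    · exact ⟨s, _, hs, mk1 a b s (by linear_combination h)⟩
    · exact ⟨s, _, hs, by rw [Sym2.eq_swap]; exact mk3 b a s (by linear_combination -h)⟩
    · exact ⟨s, _, hs, mk3 a b s (by linear_combination h)⟩

lemma Data.diag_desc (H : Data x y w S) (π : F ≃ V) {s t a b : F} (hs : S s)
    (h : DiagOf (cycOf π w y s t) (π a) (π b)) :
    ((a = t ∧ b = t + s * (1 - w)) ∨ (b = t ∧ a = t + s * (1 - w))) ∨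
    ((a = t + s ∧ b = t + s * (w * y)) ∨ (b = t + s ∧ a = t + s * (w * y))) := by
  have := diag_cyc (H.nodup π hs) h
  simp only [EmbeddingLike.apply_eq_iff_eq] at this
  tauto

lemma Data.diag_sq (H : Data x y w S) (π : F ≃ V) {s t a b : F} (hs : S s)
    (h : DiagOf (cycOf π w y s t) (π a) (π b)) :
    (b - a) ^ 2 = (s * (1 - w)) ^ 2 ∨ (b - a) ^ 2 = (s * (1 - w * y)) ^ 2 := by
  rcases H.diag_desc π hs h with (⟨rfl, rfl⟩ | ⟨rfl, rfl⟩) | (⟨rfl, rfl⟩ | ⟨rfl, rfl⟩)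
  · left; ring
  · left; ring
  · right; ring
  · right; ring

lemma Data.diag_unique (H : Data x y w S) (π : F ≃ V) {s t s' t' a b : F} (hs : S s) (hs' : S s')
    (h : DiagOf (cycOf π w y s t) (π a) (π b)) (h' : DiagOf (cycOf π w y s' t') (π a) (π b)) :
    s = s' ∧ t = t' := by
  obtain ⟨d1, d2⟩ := H.D0
  have z1 := H.s0 s hs
  have z2 := H.s0 s' hs'
  have two := H.two
  have p1 := H.pD ((H.sq s hs).mul (H.sq s' hs')) z1 z2
  have p2 := H.pD ((H.sq s' hs').mul (H.sq s hs)) z2 z1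
  have cx : ∀ {c : F}, c ≠ 0 → (s * c) ^ 2 = (s' * c) ^ 2 → s = s' := by
    intro c hc hh
    apply H.u1 s s' hs hs'
    rw [mul_pow, mul_pow] at hh
    exact mul_right_cancel₀ (pow_ne_zero 2 hc) hh
  have key : s = s' := by
    rcases H.diag_sq π hs h with k | k <;> rcases H.diag_sq π hs' h' with k' | k' <;>
      have k2 := k.symm.trans k'
    · exact cx d1 k2
    · exact absurd k2 p1
    · exact absurd k2.symm p2
    · exact cx d2 k2
  subst key
  refine ⟨rfl, ?_⟩
  have n1 : 2 * (s * (1 - w)) ≠ 0 := mul_ne_zero two (mul_ne_zero z1 d1)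
  have n2 : 2 * (s * (1 - w * y)) ≠ 0 := mul_ne_zero two (mul_ne_zero z1 d2)
  rcases H.diag_desc π hs h with (⟨r1, r2⟩ | ⟨r1, r2⟩) | (⟨r1, r2⟩ | ⟨r1, r2⟩) <;>
  rcases H.diag_desc π hs h' with (⟨l1, l2⟩ | ⟨l1, l2⟩) | (⟨l1, l2⟩ | ⟨l1, l2⟩)
  · linear_combination l1 - r1
  · exact (n1 (by linear_combination r1 - r2 - l2 + l1)).elim
  · have e1 : (b - a) ^ 2 = (s * (1 - w)) ^ 2 := by rw [r1, r2]; ring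
    have e2 : (b - a) ^ 2 = (s * (1 - w * y)) ^ 2 := by rw [l1, l2]; ring
    exact (p1 (e1.symm.trans e2)).elim
  · have e1 : (b - a) ^ 2 = (s * (1 - w)) ^ 2 := by rw [r1, r2]; ring
    have e2 : (b - a) ^ 2 = (s * (1 - w * y)) ^ 2 := by rw [l1, l2]; ring
    exact (p1 (e1.symm.trans e2)).elim
  · exact (n1 (by linear_combination r1 - r2 - l2 + l1)).elim
  · linear_combination l1 - r1
  · have e1 : (b - a) ^ 2 = (s * (1 - w)) ^ 2 := by rw [r1, r2]; ring
    have e2 : (b - a) ^ 2 = (s * (1 - w * y)) ^ 2 := by rw [l1, l2]; ring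
    exact (p1 (e1.symm.trans e2)).elim
  · have e1 : (b - a) ^ 2 = (s * (1 - w)) ^ 2 := by rw [r1, r2]; ring
    have e2 : (b - a) ^ 2 = (s * (1 - w * y)) ^ 2 := by rw [l1, l2]; ring
    exact (p1 (e1.symm.trans e2)).elim
  · have e1 : (b - a) ^ 2 = (s * (1 - w)) ^ 2 := by rw [l1, l2]; ring
    have e2 : (b - a) ^ 2 = (s * (1 - w * y)) ^ 2 := by rw [r1, r2]; ring
    exact (p1 (e1.symm.trans e2)).elim
  · have e1 : (b - a) ^ 2 = (s * (1 - w)) ^ 2 := by rw [l1, l2]; ring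
    have e2 : (b - a) ^ 2 = (s * (1 - w * y)) ^ 2 := by rw [r1, r2]; ring
    exact (p1 (e1.symm.trans e2)).elim
  · linear_combination l1 - r1
  · exact (n2 (by linear_combination -(r1 - r2) - (l1 - l2))).elim
  · have e1 : (b - a) ^ 2 = (s * (1 - w)) ^ 2 := by rw [l1, l2]; ring
    have e2 : (b - a) ^ 2 = (s * (1 - w * y)) ^ 2 := by rw [r1, r2]; ring
    exact (p1 (e1.symm.trans e2)).elim
  · have e1 : (b - a) ^ 2 = (s * (1 - w)) ^ 2 := by rw [l1, l2]; ring
    have e2 : (b - a) ^ 2 = (s * (1 - w * y)) ^ 2 := by rw [r1, r2]; ring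
    exact (p1 (e1.symm.trans e2)).elim
  · exact (n2 (by linear_combination -(r1 - r2) - (l1 - l2))).elim
  · linear_combination l1 - r1

lemma Data.opp_false (H : Data x y w S) (π : F ≃ V) {s t s1 t1 s2 t2 : F} (hs : S s) (hs1 : S s1)
    (hs2 : S s2) {a b c d : V} (hn : ([a, b, c, d] : List V).Nodup)
    (h : cycOf π w y s t = cycEdges a b c d) (h1 : DiagOf (cycOf π w y s1 t1) a b)
    (h2 : DiagOf (cycOf π w y s2 t2) c d) : False := by
  obtain ⟨a, rfl⟩ := π.surjective a
  obtain ⟨b, rfl⟩ := π.surjective b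
  obtain ⟨c, rfl⟩ := π.surjective c
  obtain ⟨d, rfl⟩ := π.surjective d
  obtain ⟨d1, d2⟩ := H.D0
  have z := H.s0 s hs
  have z1 := H.s0 s1 hs1
  have z2 := H.s0 s2 hs2
  have hr := H.rel
  have g1 := H.diag_sq π hs1 h1
  have g2 := H.diag_sq π hs2 h2
  have sqs := fun p q : F => sq_eq_sq_iff_eq_or_eq_neg (a := p) (b := q)
  have main : ∀ e f : F, e ≠ 0 → IsSquare f → f ≠ 0 →
      (∀ r r', S r → S r' → r ^ 2 ≠ (f * r') ^ 2) →
      ∀ p q r r' : F, S r → S r' → p ^ 2 = e ^ 2 → q ^ 2 = (f * e) ^ 2 →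
      (p ^ 2 = (r * (1 - w)) ^ 2 ∨ p ^ 2 = (r * (1 - w * y)) ^ 2) →
      (q ^ 2 = (r' * (1 - w)) ^ 2 ∨ q ^ 2 = (r' * (1 - w * y)) ^ 2) → False := by
    intro e f he hf hf0 hu p q r r' hr hr' hp hq h1 h2
    have w1 := H.s0 r hr
    have w2 := H.s0 r' hr'
    have sq' : IsSquare (r' * (f * r)) := (H.sq r' hr').mul (hf.mul (H.sq r hr))
    have sqb : IsSquare (f * r * r') := (hf.mul (H.sq r hr)).mul (H.sq r' hr')
    rcases h1 with h1 | h1 <;> rcases h2 with h2 | h2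
    · apply hu r' r hr' hr
      apply mul_right_cancel₀ (pow_ne_zero 2 d1)
      linear_combination -h2 + hq - f ^ 2 * hp + f ^ 2 * h1
    · apply H.pD sqb (mul_ne_zero hf0 w1) w2
      linear_combination h2 - hq + f ^ 2 * hp - f ^ 2 * h1
    · apply H.pD sq' w2 (mul_ne_zero hf0 w1)
      linear_combination -h2 + hq - f ^ 2 * hp + f ^ 2 * h1
    · apply hu r' r hr' hr
      apply mul_right_cancel₀ (pow_ne_zero 2 d2)
      linear_combination -h2 + hq - f ^ 2 * hp + f ^ 2 * h1
  have mx := main s x z H.sqx H.x0 H.ux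
  have my := main (w * s) y (mul_ne_zero H.w0 z) H.sqy H.y0 H.uy
  have o := opp_cyc hn (H.nodup π (t := t) hs) h.symm
  simp only [Sym2.eq_iff, EmbeddingLike.apply_eq_iff_eq] at o
  rcases o with ⟨o1, o2⟩ | ⟨o1, o2⟩ | ⟨o1, o2⟩ | ⟨o1, o2⟩
  · refine mx (b - a) (d - c) s1 s2 hs1 hs2 ?_ ?_ g1 g2
    · rcases o1 with ⟨rfl, rfl⟩ | ⟨rfl, rfl⟩ <;> ring
    · have : x * s = s * (w * y) - s * (1 - w) := by linear_combination -s * hr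
      rw [this]
      rcases o2 with ⟨rfl, rfl⟩ | ⟨rfl, rfl⟩ <;> ring
  · refine mx (d - c) (b - a) s2 s1 hs2 hs1 ?_ ?_ g2 g1
    · rcases o2 with ⟨rfl, rfl⟩ | ⟨rfl, rfl⟩ <;> ring
    · have : x * s = s * (w * y) - s * (1 - w) := by linear_combination -s * hr
      rw [this]
      rcases o1 with ⟨rfl, rfl⟩ | ⟨rfl, rfl⟩ <;> ring
  · refine my (b - a) (d - c) s1 s2 hs1 hs2 ?_ ?_ g1 g2
    · rcases o1 with ⟨rfl, rfl⟩ | ⟨rfl, rfl⟩ <;> ring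
    · rcases o2 with ⟨rfl, rfl⟩ | ⟨rfl, rfl⟩ <;> ring
  · refine my (d - c) (b - a) s2 s1 hs2 hs1 ?_ ?_ g2 g1
    · rcases o2 with ⟨rfl, rfl⟩ | ⟨rfl, rfl⟩ <;> ring
    · rcases o1 with ⟨rfl, rfl⟩ | ⟨rfl, rfl⟩ <;> ring

open Classical in
lemma Data.exists_system [Fintype F] (H : Data x y w S) (π : F ≃ V) :
    ∃ C : Finset (Finset (Sym2 V)), IsFourCycleSystem C ∧ StrictlyRSparse 4 C := by
  set C : Finset (Finset (Sym2 V)) :=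
    ((Finset.univ : Finset (F × F)).filter (fun p => S p.1)).image
      (fun p => cycOf π w y p.1 p.2) with hCdef
  have mem : ∀ E, E ∈ C ↔ ∃ s t, S s ∧ E = cycOf π w y s t := by
    intro E
    simp only [hCdef, Finset.mem_image, Finset.mem_filter, Finset.mem_univ, true_and, Prod.exists]
    constructor
    · rintro ⟨s, t, h, rfl⟩; exact ⟨s, t, h, rfl⟩
    · rintro ⟨s, t, h, rfl⟩; exact ⟨s, t, h, rfl⟩
  have hcyc : ∀ E ∈ C, IsFourCycle E := by
    intro E hE
    obtain ⟨s, t, hs, rfl⟩ := (mem E).1 hE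
    exact ⟨_, _, _, _, H.nodup π hs, rfl⟩
  have hedge : ∀ E ∈ C, ∀ F ∈ C, ∀ e, e ∈ E → e ∈ F → E = F := by
    intro E hE F hF e h1 h2
    obtain ⟨s, t, hs, rfl⟩ := (mem E).1 hE
    obtain ⟨s', t', hs', rfl⟩ := (mem F).1 hF
    induction e with | _ a b
    obtain ⟨a, rfl⟩ := π.surjective a
    obtain ⟨b, rfl⟩ := π.surjective b
    obtain ⟨rfl, rfl⟩ := H.edge_unique π hs hs' h1 h2
    rfl
  refine ⟨C, ⟨hcyc, ?_⟩, Good.strict ⟨hcyc, hedge, ?_, ?_⟩⟩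
  · intro e he
    induction e with | _ a b
    obtain ⟨a, rfl⟩ := π.surjective a
    obtain ⟨b, rfl⟩ := π.surjective b
    obtain ⟨s, t, hs, h⟩ := H.edge_exists π (a := a) (b := b) (by rintro rfl; simp at he)
    refine ⟨_, ⟨(mem _).2 ⟨s, t, hs, rfl⟩, h⟩, ?_⟩
    rintro E ⟨hE, hE'⟩
    exact hedge _ hE _ ((mem _).2 ⟨s, t, hs, rfl⟩) _ hE' h
  · intro E hE F hF u v h1 h2
    obtain ⟨s, t, hs, rfl⟩ := (mem E).1 hE
    obtain ⟨s', t', hs', rfl⟩ := (mem F).1 hF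
    obtain ⟨a, rfl⟩ := π.surjective u
    obtain ⟨b, rfl⟩ := π.surjective v
    obtain ⟨rfl, rfl⟩ := H.diag_unique π hs hs' h1 h2
    rfl
  · intro E hE F hF G hG a b c d hn hEq h1 h2
    obtain ⟨s, t, hs, rfl⟩ := (mem E).1 hE
    obtain ⟨s', t', hs', rfl⟩ := (mem F).1 hF
    obtain ⟨s2, t2, hs2, rfl⟩ := (mem G).1 hG
    exact H.opp_false π hs hs' hs2 hn hEq h1 h2

end construct

section color
variable {F : Type*} [Field F] [Fintype F]

lemma ff_two (h8 : Fintype.card F % 8 = 1) : (2 : F) ≠ 0 := by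
  intro h
  have h1 : ringChar F = 2 := by
    have : ringChar F ∣ 2 := (ringChar.spec F 2).1 (by exact_mod_cast h)
    rcases (Nat.dvd_prime Nat.prime_two).1 this with h | h
    · exact absurd h (CharP.ringChar_ne_one)
    · exact h
  have := FiniteField.even_card_of_char_two h1
  omega

lemma ff_char (h8 : Fintype.card F % 8 = 1) : ringChar F ≠ 2 := by
  intro h1
  have := FiniteField.even_card_of_char_two h1
  omega

lemma ff_neg (h8 : Fintype.card F % 8 = 1) : IsSquare (-1 : F) := by
  rw [FiniteField.isSquare_neg_one_iff]; omega

lemma ff_sq2 (h8 : Fintype.card F % 8 = 1) : IsSquare (2 : F) := by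
  rw [FiniteField.isSquare_two_iff]; omega

lemma ff_nonsq_mul {a b : F} (ha : ¬ IsSquare a) (hb : ¬ IsSquare b) : IsSquare (a * b) := by
  classical
  by_cases hF : ringChar F = 2
  · exact FiniteField.isSquare_of_char_two hF _
  have a0 : a ≠ 0 := by rintro rfl; simp at ha
  have b0 : b ≠ 0 := by rintro rfl; simp at hb
  rw [← quadraticChar_one_iff_isSquare (mul_ne_zero a0 b0), map_mul,
    (quadraticChar_neg_one_iff_not_isSquare).2 ha, (quadraticChar_neg_one_iff_not_isSquare).2 hb]
  norm_num

lemma ff_nonsq_div {a b : F} (ha : ¬ IsSquare a) (hb : ¬ IsSquare b) : IsSquare (a / b) := by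
  rw [div_eq_mul_inv]
  exact ff_nonsq_mul ha (by rwa [isSquare_inv])

/-- A system from a suitable 2-coloring of the nonzero squares. -/
lemma system_of_color (h8 : Fintype.card F % 8 = 1) {q : ℕ} (π : F ≃ Fin q) {x y : F}
    (x0 : x ≠ 0) (y0 : y ≠ 0) (sqx : IsSquare x) (sqy : IsSquare y)
    (n1 : ¬ IsSquare ((1 + x) * (1 + y))) (n2 : ¬ IsSquare ((y - x) * (1 - x * y)))
    (c : F → Prop)
    (cn : ∀ e, e ≠ 0 → IsSquare e → (c (-e) ↔ c e))
    (cx : ∀ e, e ≠ 0 → IsSquare e → (c (x * e) ↔ ¬ c e))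
    (cy : ∀ e, e ≠ 0 → IsSquare e → (c (y * e) ↔ ¬ c e)) :
    ∃ C : Finset (Finset (Sym2 (Fin q))), IsFourCycleSystem C ∧ StrictlyRSparse 4 C := by
  have y1 : 1 + y ≠ 0 := by intro h; rw [h] at n1; simp at n1
  have x1 : 1 + x ≠ 0 := by intro h; rw [h] at n1; simp at n1
  have sy : IsSquare ((1 + y) * (1 + y)) := ⟨_, rfl⟩
  have sy0 := mul_ne_zero y1 y1
  have two := ff_two h8
  have neg := ff_neg h8
  have nw : ¬ IsSquare ((1 + x) / (1 + y)) := fun h => n1 (by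
    have := h.mul sy
    rwa [show (1 + x) / (1 + y) * ((1 + y) * (1 + y)) = (1 + x) * (1 + y) by field_simp] at this)
  have half : ∀ e : F, e ≠ 0 → IsSquare e → c e → ∃ s, (s ≠ 0 ∧ IsSquare s ∧ c s ∧ π s < π (-s)) ∧
      (e = s ∨ e = -s) := by
    intro e e0 se ce
    have hne : e ≠ -e := fun h => mul_ne_zero two e0 (by linear_combination h)
    have hne' : π e ≠ π (-e) := fun h => hne (π.injective h)
    rcases lt_or_gt_of_ne hne' with h | h
    · exact ⟨e, ⟨e0, se, ce, h⟩, Or.inl rfl⟩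
    · refine ⟨-e, ⟨neg_ne_zero.2 e0, ?_, (cn e e0 se).2 ce, by rwa [neg_neg]⟩, Or.inr (neg_neg e).symm⟩
      rw [neg_eq_neg_one_mul]; exact neg.mul se
  have ex : ∀ f : F, f ≠ 0 → IsSquare f → (∀ e, e ≠ 0 → IsSquare e → (c (f * e) ↔ ¬ c e)) →
      ∀ e, e ≠ 0 → IsSquare e → ∃ s, (s ≠ 0 ∧ IsSquare s ∧ c s ∧ π s < π (-s)) ∧
        (e = s ∨ e = -s ∨ e = f * s ∨ e = -(f * s)) := by
    intro f f0 sf cf e e0 se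
    by_cases ce : c e
    · obtain ⟨s, hs, h⟩ := half e e0 se ce
      exact ⟨s, hs, h.imp_right Or.inl⟩
    · have hfe : f * (e / f) = e := by field_simp
      have ce' : c (e / f) := by
        have := cf (e / f) (div_ne_zero e0 f0) (se.div sf)
        rw [hfe] at this
        tauto
      obtain ⟨s, hs, h⟩ := half (e / f) (div_ne_zero e0 f0) (se.div sf) ce'
      refine ⟨s, hs, ?_⟩
      rcases h with h | h
      · right; right; left; rw [← hfe, h]
      · right; right; right; rw [← hfe, h]; ring
  have ux : ∀ f : F, f ≠ 0 → IsSquare f → (∀ e, e ≠ 0 → IsSquare e → (c (f * e) ↔ ¬ c e)) →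
      ∀ s s', (s ≠ 0 ∧ IsSquare s ∧ c s ∧ π s < π (-s)) →
        (s' ≠ 0 ∧ IsSquare s' ∧ c s' ∧ π s' < π (-s')) → s ^ 2 ≠ (f * s') ^ 2 := by
    rintro f f0 sf cf s s' ⟨_, _, cs, _⟩ ⟨h1, h2, cs', _⟩ h
    have k := cf s' h1 h2
    have k' := cn (f * s') (mul_ne_zero f0 h1) (sf.mul h2)
    rcases sq_eq_sq_iff_eq_or_eq_neg.1 h with rfl | rfl <;> tauto
  refine Data.exists_system (x := x) (y := y) (w := (1 + x) / (1 + y))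
    (S := fun s => s ≠ 0 ∧ IsSquare s ∧ c s ∧ π s < π (-s)) ?_ π
  refine ⟨by field_simp, two, x0, y0, div_ne_zero x1 y1, sqx, sqy, neg, nw, ?_,
    fun s h => h.1, fun s h => h.2.1, ?_, ux x x0 sqx cx, ux y y0 sqy cy, ex x x0 sqx cx,
    ex y y0 sqy cy, fun e he => ff_nonsq_div he nw⟩
  · intro h
    apply n2
    have := h.mul sy
    rwa [show (1 - (1 + x) / (1 + y)) * (1 - (1 + x) / (1 + y) * y) * ((1 + y) * (1 + y))
      = (y - x) * (1 - x * y) by field_simp; ring] at this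
  · rintro s s' ⟨_, _, _, l⟩ ⟨_, _, _, lb⟩ h
    rcases sq_eq_sq_iff_eq_or_eq_neg.1 h with h | rfl
    · exact h
    · rw [neg_neg] at l
      exact (lt_asymm l lb).elim

/-- Abstract coloring of a commutative group. -/
lemma group_color {G : Type*} [CommGroup G] (H : Subgroup G) (x : G) (hx : x ∉ H)
    (hx2 : x * x ∈ H) : ∃ c : G → Prop, (∀ h ∈ H, ∀ e, (c (h * e) ↔ c e)) ∧
      ∀ e, (c (x * e) ↔ ¬ c e) := by
  let K : Subgroup G :=
    { carrier := {k | k ∈ H ∨ x * k ∈ H}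
      one_mem' := Or.inl H.one_mem
      mul_mem' := by
        rintro a b (ha | ha) (hb | hb)
        · exact Or.inl (H.mul_mem ha hb)
        · exact Or.inr (by rw [mul_left_comm]; exact H.mul_mem ha hb)
        · exact Or.inr (by rw [← mul_assoc]; exact H.mul_mem ha hb)
        · refine Or.inl ?_
          have := H.mul_mem (H.inv_mem hx2) (H.mul_mem ha hb)
          rwa [show (x * x)⁻¹ * (x * a * (x * b)) = a * b by
            rw [mul_mul_mul_comm, inv_mul_cancel_left]] at this
      inv_mem' := by
        rintro a (ha | ha)
        · exact Or.inl (H.inv_mem ha)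
        · refine Or.inr ?_
          have := H.mul_mem hx2 (H.inv_mem ha)
          rwa [show (x * x) * (x * a)⁻¹ = x * a⁻¹ by
            rw [mul_inv, mul_mul_mul_comm, mul_inv_cancel, one_mul]] at this }
  have HK : ∀ h ∈ H, h ∈ K := fun h hh => Or.inl hh
  have xK : x ∈ K := Or.inr hx2
  let r : G → G := fun e => (QuotientGroup.mk (s := K) e).out
  have rK : ∀ k ∈ K, ∀ e, r (k * e) = r e := by
    intro k hk e
    have : (QuotientGroup.mk (s := K) (k * e)) = QuotientGroup.mk e := by
      rw [QuotientGroup.eq]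
      rw [show (k * e)⁻¹ * e = k⁻¹ by rw [mul_inv, inv_mul_cancel_right]]
      exact K.inv_mem hk
    simp only [r, this]
  have rm : ∀ e, e * (r e)⁻¹ ∈ K := by
    intro e
    have : (QuotientGroup.mk (s := K) (r e)) = QuotientGroup.mk e := by
      simp only [r, QuotientGroup.out_eq']
    rw [QuotientGroup.eq] at this
    rwa [mul_comm]
  refine ⟨fun e => e * (r e)⁻¹ ∈ H, ?_, ?_⟩
  · intro h hh e
    simp only [rK h (HK h hh), mul_assoc]
    exact H.mul_mem_cancel_left hh
  · intro e
    simp only [rK x xK, mul_assoc]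
    have := rm e
    constructor
    · intro h1 h2
      exact hx ((H.mul_mem_cancel_right h2).1 h1)
    · intro h
      exact this.resolve_left h

lemma system_of_z_aux (h8 : Fintype.card F % 8 = 1) {q : ℕ} (π : F ≃ Fin q) {u : F} (u0 : u ≠ 0)
    (n1 : ¬ IsSquare (1 - u ^ 4)) (n2 : ¬ IsSquare (1 + u ^ 4))
    (hodd : ∀ j : ℤ, (u ^ 4) ^ (2 * j + 1) ≠ 1) :
    ∃ C : Finset (Finset (Sym2 (Fin q))), IsFourCycleSystem C ∧ StrictlyRSparse 4 C := by
  set X : Fˣ := Units.mk0 (u ^ 2) (pow_ne_zero 2 u0) with hX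
  have neg := ff_neg h8
  obtain ⟨c, c1, c2⟩ := group_color (Subgroup.zpowers (-1 : Fˣ) ⊔ Subgroup.zpowers (X ^ 2)) X (by
    intro h
    obtain ⟨a, ha, b, hb, hab⟩ := Subgroup.mem_sup.1 h
    obtain ⟨k, rfl⟩ := Subgroup.mem_zpowers_iff.1 ha
    obtain ⟨n, rfl⟩ := Subgroup.mem_zpowers_iff.1 hb
    have h1 : ((-1 : Fˣ) ^ k) ^ 2 = 1 := by
      rw [← zpow_natCast, zpow_comm]; simp
    have h2 : ((X ^ 2) ^ n) ^ 2 = X ^ 2 := by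
      have h3 := congrArg (fun g => g ^ 2) hab
      simp only [mul_pow, h1, one_mul] at h3
      simpa using h3
    have h3 : (X ^ 2) ^ (2 * (n - 1) + 1) = 1 := by
      have e : (2 * (n - 1) + 1 : ℤ) = n * 2 - 1 := by ring
      rw [e, zpow_sub, zpow_mul, zpow_one]
      rw [show ((X ^ 2) ^ n) ^ (2 : ℤ) = ((X ^ 2) ^ n) ^ 2 from rfl, h2, mul_inv_cancel]
    apply hodd (n - 1)
    have := congrArg (fun t : Fˣ => (t : F)) h3
    simpa [hX, ← pow_mul] using this) (by
    rw [← pow_two]; exact Subgroup.mem_sup_right (Subgroup.mem_zpowers _))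
  have m1 : ∀ e, c (-e) ↔ c e := by
    intro e
    rw [neg_eq_neg_one_mul]
    exact c1 _ (Subgroup.mem_sup_left (Subgroup.mem_zpowers _)) e
  classical
  let c' : F → Prop := fun e => if h : e = 0 then False else c (Units.mk0 e h)
  have cc : ∀ e (h : e ≠ 0), c' e ↔ c (Units.mk0 e h) := fun e h => by simp [c', h]
  have x0 : u ^ 2 ≠ 0 := pow_ne_zero 2 u0
  have hcn : ∀ e, e ≠ 0 → (c' (-e) ↔ c' e) := by
    intro e e0
    rw [cc e e0, cc (-e) (neg_ne_zero.2 e0), ← m1]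
    apply iff_of_eq; congr 1; ext; simp
  have hcx : ∀ e, e ≠ 0 → (c' (u ^ 2 * e) ↔ ¬ c' e) := by
    intro e e0
    rw [cc e e0, cc _ (mul_ne_zero x0 e0), ← c2]
    apply iff_of_eq; congr 1; ext; simp [hX]
  refine system_of_color h8 π (x := u ^ 2) (y := - u ^ 2) x0 (neg_ne_zero.2 x0) ⟨u, by ring⟩ ?_ ?_ ?_
    c' (fun e he _ => hcn e he) (fun e he _ => hcx e he) ?_
  · rw [neg_eq_neg_one_mul]; exact neg.mul ⟨u, by ring⟩
  · rwa [show (1 + u ^ 2) * (1 + -u ^ 2) = 1 - u ^ 4 by ring]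
  · intro h
    apply n2
    refine isSquare_of_mul (b := (-1) * 2 * (u * u)) ((neg.mul (ff_sq2 h8)).mul ⟨u, rfl⟩) ?_ ?_
    · exact mul_ne_zero (mul_ne_zero (neg_ne_zero.2 one_ne_zero) (ff_two h8)) (mul_ne_zero u0 u0)
    · rwa [show (1 + u ^ 4) * ((-1) * 2 * (u * u)) = (-u ^ 2 - u ^ 2) * (1 - u ^ 2 * -u ^ 2) by ring]
  · intro e e0 _
    rw [neg_mul, hcn _ (mul_ne_zero x0 e0)]
    exact hcx e e0

lemma ff_zeta (h8 : Fintype.card F % 8 = 1) : ∃ t : F, t ^ 4 = -1 := by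
  obtain ⟨i, hi⟩ := ff_neg h8
  have i0 : i ≠ 0 := by rintro rfl; simp at hi
  have : IsSquare i := by
    rw [FiniteField.isSquare_iff (ff_char h8) i0]
    obtain ⟨k, hk⟩ : ∃ k, Fintype.card F / 2 = 4 * k := ⟨Fintype.card F / 8, by omega⟩
    rw [hk, pow_mul, show i ^ 4 = (i * i) * (i * i) by ring, ← hi]; simp
  obtain ⟨t, ht⟩ := this
  exact ⟨t, by rw [hi, ht]; ring⟩

lemma system_of_z (h8 : Fintype.card F % 8 = 1) {q : ℕ} (π : F ≃ Fin q) {u : F} (u0 : u ≠ 0)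
    (n1 : ¬ IsSquare (1 - u ^ 4)) (n2 : ¬ IsSquare (1 + u ^ 4)) :
    ∃ C : Finset (Finset (Sym2 (Fin q))), IsFourCycleSystem C ∧ StrictlyRSparse 4 C := by
  by_cases hodd : ∀ j : ℤ, (u ^ 4) ^ (2 * j + 1) ≠ 1
  · exact system_of_z_aux h8 π u0 n1 n2 hodd
  push Not at hodd
  obtain ⟨j, hj⟩ := hodd
  obtain ⟨t, ht⟩ := ff_zeta h8
  have t0 : t ≠ 0 := by rintro rfl; simp at ht
  have e : (t * u) ^ 4 = - u ^ 4 := by rw [mul_pow, ht]; ring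
  refine system_of_z_aux h8 π (mul_ne_zero t0 u0) ?_ ?_ ?_
  · rwa [e, sub_neg_eq_add]
  · rwa [e, ← sub_eq_add_neg]
  · intro k hk
    rw [e] at hk
    have h1 : ((- u ^ 4) ^ (2 * k + 1)) ^ (2 * j + 1) = 1 := by rw [hk, one_zpow]
    have o : ∀ k : ℤ, (-1 : F) ^ (2 * k + 1) = -1 := fun k => Odd.neg_one_zpow ⟨k, rfl⟩
    rw [zpow_comm, neg_eq_neg_one_mul (u ^ 4), mul_zpow, hj, o, mul_one, o] at h1
    exact ff_two h8 (by linear_combination -h1)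

end color

section exists_z
variable {F : Type*} [Field F] [Fintype F]

lemma sq_of_pow_eq (h8 : Fintype.card F % 8 = 1) {u v : F} (h : u ^ 4 = v ^ 8) : IsSquare u := by
  have neg := ff_neg h8
  obtain ⟨t, ht⟩ := ff_zeta h8
  have : (u ^ 2) ^ 2 = (v ^ 4) ^ 2 := by linear_combination h
  rcases sq_eq_sq_iff_eq_or_eq_neg.1 this with h | h
  · exact isSquare_of_sq_eq neg (b := v * v) (by linear_combination h) ⟨v, rfl⟩
  · exact isSquare_of_sq_eq neg (b := (t * v) * (t * v)) (by linear_combination h - v ^ 4 * ht)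
      ⟨_, rfl⟩

open Classical in
lemma all_sq (h8 : Fintype.card F % 8 = 1)
    (hyp : ∀ u : F, u ≠ 0 → ¬ IsSquare (1 - u ^ 4) → IsSquare (1 + u ^ 4)) (u : F)
    (hu : ¬ IsSquare u) : IsSquare (1 - u ^ 4) ∧ 1 - u ^ 4 ≠ 0 := by
  have u0 : u ≠ 0 := by rintro rfl; simp at hu
  constructor
  swap
  · intro h
    exact hu (sq_of_pow_eq h8 (v := 1) (by linear_combination -h))
  by_contra hns
  set N : Finset F := Finset.univ.filter (fun z => (∃ v : F, v ≠ 0 ∧ z = v ^ 4) ∧ ¬ IsSquare (1 - z))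
    with hN
  have mem : ∀ z, z ∈ N ↔ (∃ v : F, v ≠ 0 ∧ z = v ^ 4) ∧ ¬ IsSquare (1 - z) := by
    intro z; simp [hN]
  have maps : Set.MapsTo (fun z : F => z ^ 2) N N := by
    intro z hz
    simp only [Finset.mem_coe, mem] at hz ⊢
    obtain ⟨⟨v, v0, rfl⟩, h⟩ := hz
    refine ⟨⟨v ^ 2, pow_ne_zero 2 v0, by ring⟩, fun h2 => h ?_⟩
    refine isSquare_of_mul (hyp v v0 h) ?_ ?_
    · intro h1
      apply h
      have := ff_sq2 h8
      rwa [show (2 : F) = 1 - v ^ 4 by linear_combination h1] at this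
    · rwa [show (1 - v ^ 4) * (1 + v ^ 4) = 1 - (v ^ 4) ^ 2 by ring]
  have inj : Set.InjOn (fun z : F => z ^ 2) N := by
    intro z hz z' hz' hzz
    simp only [Finset.mem_coe, mem] at hz hz'
    obtain ⟨⟨v, v0, rfl⟩, h⟩ := hz
    obtain ⟨⟨v', v0', rfl⟩, h'⟩ := hz'
    rcases sq_eq_sq_iff_eq_or_eq_neg.1 hzz with h1 | h1
    · exact h1
    · exact (h (by rw [h1, sub_neg_eq_add]; exact hyp v' v0' h')).elim
  have surj := Finset.surjOn_of_injOn_of_card_le _ maps inj le_rfl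
  obtain ⟨z, hz, hzu⟩ := surj (show u ^ 4 ∈ (N : Set F) from (mem _).2 ⟨⟨u, u0, rfl⟩, hns⟩)
  obtain ⟨⟨v, _, rfl⟩, _⟩ := (mem z).1 hz
  exact hu (sq_of_pow_eq h8 (v := v) (by rw [← hzu]; ring))

lemma card_pow_le [DecidableEq F] (s : Finset F) (n : ℕ) (hn : 0 < n) (a : F) :
    (s.filter (fun v => v ^ n = a)).card ≤ n := by
  refine (Finset.card_le_card (t := (Polynomial.nthRoots n a).toFinset) ?_).trans
    ((Multiset.toFinset_card_le _).trans (Polynomial.card_nthRoots n a))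
  intro v hv
  rw [Multiset.mem_toFinset, Polynomial.mem_nthRoots hn]
  exact (Finset.mem_filter.1 hv).2

lemma char_corr [DecidableEq F] (h8 : Fintype.card F % 8 = 1) {b c : F} (hbc : b ≠ c) :
    ∑ a, quadraticChar F (a - b) * quadraticChar F (a - c) = -1 := by
  have hc := ff_char h8
  have hneg : quadraticChar F (-1) = 1 :=
    (quadraticChar_one_iff_isSquare (neg_ne_zero.2 one_ne_zero)).2 (ff_neg h8)
  have J := jacobiSum_nontrivial_inv (quadraticChar_ne_one hc)
  rw [(quadraticChar_isQuadratic F).inv, hneg, jacobiSum] at J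
  rw [← J]
  have d0 : c - b ≠ 0 := sub_ne_zero.2 hbc.symm
  let e : F ≃ F := (Equiv.mulLeft₀ (c - b) d0).trans (Equiv.addLeft b)
  rw [← Equiv.sum_comp e]
  refine Finset.sum_congr rfl fun x _ => ?_
  have e1 : e x - b = (c - b) * x := by simp [e]
  have e2 : e x - c = (c - b) * ((-1) * (1 - x)) := by simp [e]; ring
  rw [e1, e2, map_mul, map_mul, map_mul, hneg]
  have := quadraticChar_sq_one d0
  linear_combination (quadraticChar F x * quadraticChar F (1 - x)) * this

lemma char_corr_self [DecidableEq F] (b : F) :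
    ∑ a, quadraticChar F (a - b) * quadraticChar F (a - b) = (Fintype.card F : ℤ) - 1 := by
  rw [← Equiv.sum_comp (Equiv.addRight b)]
  have : ∀ x : F, quadraticChar F ((Equiv.addRight b) x - b) * quadraticChar F ((Equiv.addRight b) x - b)
      = 1 - if x = 0 then 1 else 0 := by
    intro x
    have : (Equiv.addRight b) x - b = x := by simp
    rw [this]
    split_ifs with h
    · simp [h]
    · rw [← pow_two, quadraticChar_sq_one h]; simp
  rw [Finset.sum_congr rfl fun x _ => this x]
  simp [Finset.sum_sub_distrib]

lemma card_nonsq [DecidableEq F] (h8 : Fintype.card F % 8 = 1) :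
    (Fintype.card F : ℤ) = 2 * ((Finset.univ.filter (fun u : F => quadraticChar F u = -1)).card : ℤ) + 1 := by
  have h0 := quadraticChar_sum_zero (ff_char h8)
  have h1 : ∑ a : F, (1 - quadraticChar F a) = ∑ a : F, ((2 * if quadraticChar F a = -1 then 1 else 0) +
      if a = 0 then 1 else 0) := by
    refine Finset.sum_congr rfl fun a _ => ?_
    by_cases ha : a = 0
    · simp [ha]
    · rcases quadraticChar_dichotomy ha with h | h <;> simp [h, ha]
  rw [Finset.sum_sub_distrib, h0, Finset.sum_add_distrib, ← Finset.mul_sum, Finset.sum_boole] at h1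
  simpa using h1

open Classical in
lemma exists_z (h8 : Fintype.card F % 8 = 1) (hq : 57 < Fintype.card F) :
    ∃ u : F, u ≠ 0 ∧ ¬ IsSquare (1 - u ^ 4) ∧ ¬ IsSquare (1 + u ^ 4) := by
  by_contra hcon
  push Not at hcon
  have A := all_sq h8 hcon
  set χ := quadraticChar F with hχ
  set U := Finset.univ.filter (fun u : F => χ u = -1) with hU
  have hm := card_nonsq h8
  rw [← hχ, ← hU] at hm
  set m : ℤ := (U.card : ℤ) with hmdef
  have memU : ∀ u, u ∈ U ↔ ¬ IsSquare u := by
    intro u; simp only [hU, Finset.mem_filter, Finset.mem_univ, true_and]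
    exact quadraticChar_neg_one_iff_not_isSquare
  let T : F → ℤ := fun a => ∑ u ∈ U, χ (a - u ^ 4)
  have hT : ∀ v : F, v ≠ 0 → T (v ^ 8) = m := by
    intro v v0
    have : ∀ u ∈ U, χ (v ^ 8 - u ^ 4) = 1 := by
      intro u hu
      have hu' : ¬ IsSquare (u / (v * v)) := fun h => (memU u).1 hu (by
        have := h.mul ⟨v, rfl⟩
        rwa [div_mul_cancel₀ _ (mul_ne_zero v0 v0)] at this)
      obtain ⟨h1, h2⟩ := A _ hu'
      have e : v ^ 8 - u ^ 4 = (v ^ 4 * v ^ 4) * (1 - (u / (v * v)) ^ 4) := by field_simp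
      rw [e]
      refine (quadraticChar_one_iff_isSquare ?_).2 ?_
      · exact mul_ne_zero (mul_ne_zero (pow_ne_zero 4 v0) (pow_ne_zero 4 v0)) h2
      · exact IsSquare.mul ⟨_, rfl⟩ h1
    simp only [T]
    rw [Finset.sum_congr rfl this]
    simp [hmdef]
  have S1 : ∑ a, T a ^ 2 ≤ 4 * m * (Fintype.card F : ℤ) - m ^ 2 := by
    have h1 : ∑ a, T a ^ 2 = ∑ u ∈ U, ∑ u' ∈ U, ∑ a, χ (a - u ^ 4) * χ (a - u' ^ 4) := by
      simp only [T, pow_two, Finset.sum_mul_sum]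
      rw [Finset.sum_comm]
      refine Finset.sum_congr rfl fun u _ => ?_
      rw [Finset.sum_comm]
    have h2 : ∀ u u' : F, ∑ a, χ (a - u ^ 4) * χ (a - u' ^ 4) =
        (Fintype.card F : ℤ) * (if u' ^ 4 = u ^ 4 then 1 else 0) - 1 := by
      intro u u'
      split_ifs with h
      · rw [h, char_corr_self]; ring
      · rw [char_corr h8 (Ne.symm h)]; ring
    rw [h1]
    simp only [h2, Finset.sum_sub_distrib, ← Finset.mul_sum, Finset.sum_boole]
    have h3 : ∑ u ∈ U, ((U.filter (fun u' => u' ^ 4 = u ^ 4)).card : ℤ) ≤ ∑ u ∈ U, 4 :=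
      Finset.sum_le_sum fun u _ => by exact_mod_cast card_pow_le U 4 (by norm_num) _
    have h4 : ∑ u ∈ U, (4 : ℤ) = m * 4 := by simp [hmdef]
    have h5 : ∑ u ∈ U, ∑ u' ∈ U, (1 : ℤ) = m ^ 2 := by simp [hmdef, pow_two]
    rw [h4] at h3
    rw [h5]
    nlinarith [Int.natCast_nonneg (Fintype.card F)]
  have S2 : ∑ v ∈ Finset.univ.filter (fun v : F => v ≠ 0), T (v ^ 8) ^ 2 ≤ 8 * ∑ a, T a ^ 2 := by
    rw [← Finset.sum_fiberwise_of_maps_to (t := Finset.univ) (g := fun v : F => v ^ 8)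
      (fun _ _ => Finset.mem_univ _), Finset.mul_sum]
    refine Finset.sum_le_sum fun a _ => ?_
    rw [Finset.sum_congr rfl (g := fun _ => T a ^ 2) (fun v hv => by rw [(Finset.mem_filter.1 hv).2]),
      Finset.sum_const, nsmul_eq_mul]
    refine mul_le_mul_of_nonneg_right ?_ (sq_nonneg _)
    exact_mod_cast card_pow_le _ 8 (by norm_num) a
  have S3 : ∑ v ∈ Finset.univ.filter (fun v : F => v ≠ 0), T (v ^ 8) ^ 2 =
      ((Fintype.card F : ℤ) - 1) * m ^ 2 := by
    rw [Finset.sum_congr rfl (g := fun _ => m ^ 2)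
      (fun v hv => by rw [hT v (Finset.mem_filter.1 hv).2]), Finset.sum_const, nsmul_eq_mul]
    congr 1
    rw [Finset.filter_ne', Finset.card_erase_of_mem (Finset.mem_univ _), Finset.card_univ]
    rw [Nat.cast_sub Fintype.card_pos]; simp
  have hq' : (57 : ℤ) < Fintype.card F := by exact_mod_cast hq
  rw [hm] at hq' S1 S3
  have m29 : 29 ≤ m := by omega
  have : 2 * m * m ^ 2 ≤ 8 * (4 * m * (2 * m + 1) - m ^ 2) := by nlinarith
  nlinarith [mul_nonneg (mul_nonneg (show (0:ℤ) ≤ m by omega) (show (0:ℤ) ≤ m by omega)) (show (0:ℤ) ≤ m - 29 by omega)]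

end exists_z

section small

lemma system_17 : ∃ C : Finset (Finset (Sym2 (Fin 17))), IsFourCycleSystem C ∧ StrictlyRSparse 4 C := by
  have a1 : (6 : ZMod 17) ≠ 0 := by decide
  have a2 : ∀ r : ZMod 17, 1 - 6 ^ 4 ≠ r * r := by decide
  have a3 : ∀ r : ZMod 17, 1 + 6 ^ 4 ≠ r * r := by decide
  haveI : Fact (Nat.Prime 17) := ⟨by norm_num⟩
  exact system_of_z (F := ZMod 17) (by rw [ZMod.card]) (Fintype.equivFinOfCardEq (ZMod.card 17))
    (u := 6) a1 (fun ⟨r, h⟩ => a2 r h) (fun ⟨r, h⟩ => a3 r h)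

lemma system_41 : ∃ C : Finset (Finset (Sym2 (Fin 41))), IsFourCycleSystem C ∧ StrictlyRSparse 4 C := by
  have a1 : (2 : ZMod 41) ≠ 0 := by decide
  have a2 : ∀ r : ZMod 41, 1 - 2 ^ 4 ≠ r * r := by decide
  have a3 : ∀ r : ZMod 41, 1 + 2 ^ 4 ≠ r * r := by decide
  haveI : Fact (Nat.Prime 41) := ⟨by norm_num⟩
  exact system_of_z (F := ZMod 41) (by rw [ZMod.card]) (Fintype.equivFinOfCardEq (ZMod.card 41))
    (u := 2) a1 (fun ⟨r, h⟩ => a2 r h) (fun ⟨r, h⟩ => a3 r h)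

lemma system_49 : ∃ C : Finset (Finset (Sym2 (Fin 49))), IsFourCycleSystem C ∧ StrictlyRSparse 4 C := by
  haveI : Fact (Nat.Prime 7) := ⟨by norm_num⟩
  letI : Fintype (GaloisField 7 2) := Fintype.ofFinite _
  have hc : Fintype.card (GaloisField 7 2) = 49 := by
    rw [Fintype.card_eq_nat_card, GaloisField.card 7 2 (by norm_num)]; norm_num
  have h8 : Fintype.card (GaloisField 7 2) % 8 = 1 := by rw [hc]
  have h7 : (7 : GaloisField 7 2) = 0 := by exact_mod_cast CharP.cast_eq_zero (GaloisField 7 2) 7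
  have two := ff_two h8
  have sq : ∀ a : GaloisField 7 2, a ≠ 0 → (IsSquare a ↔ a ^ 24 = 1) := by
    intro a ha
    rw [FiniteField.isSquare_iff (ff_char h8) ha, hc]
  have key : ∀ i : GaloisField 7 2, -1 = i * i → ¬ IsSquare (1 + 2 * i) := by
    intro i hi h
    have p4 : (1 + 2 * i) ^ 4 = -3 * i := by
      linear_combination -(16 * i ^ 2 + 32 * i + 8) * hi + (-1 - 3 * i) * h7
    have p24 : (1 + 2 * i) ^ 24 = -1 := by
      rw [show (24 : ℕ) = 4 * 6 from rfl, pow_mul, p4]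
      linear_combination (-729) * (1 - i ^ 2 + i ^ 4) * hi - 104 * h7
    by_cases h0 : 1 + 2 * i = 0
    · rw [h0] at p24; norm_num at p24
    · rw [sq _ h0, p24] at h
      exact two (by linear_combination -h)
  obtain ⟨i, hi⟩ := ff_neg h8
  have p4 : (1 + i) ^ 4 = 3 := by
    linear_combination -(i ^ 2 + 4 * i + 5) * hi - h7
  have i0 : 1 + i ≠ 0 := by
    intro h
    rw [h] at p4
    exact one_ne_zero (α := GaloisField 7 2) (by linear_combination h7 + 2 * p4)
  have : IsSquare (1 + i) := by
    rw [sq _ i0, show (24 : ℕ) = 4 * 6 from rfl, pow_mul, p4]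
    linear_combination 104 * h7
  obtain ⟨t, ht⟩ := this
  have t4 : t ^ 4 = 2 * i := by
    linear_combination -(1 + i + t * t) * ht - hi
  refine system_of_z h8 (Fintype.equivFinOfCardEq hc) (u := t) ?_ ?_ ?_
  · rintro rfl; simp at ht; exact i0 ht
  · rw [t4, show (1 : GaloisField 7 2) - 2 * i = 1 + 2 * (-i) by ring]
    exact key _ (by rw [hi]; ring)
  · rw [t4]; exact key i hi

lemma system_25 : ∃ C : Finset (Finset (Sym2 (Fin 25))), IsFourCycleSystem C ∧ StrictlyRSparse 4 C := by
  haveI : Fact (Nat.Prime 5) := ⟨by norm_num⟩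
  letI : Fintype (GaloisField 5 2) := Fintype.ofFinite _
  have hc : Fintype.card (GaloisField 5 2) = 25 := by
    rw [Fintype.card_eq_nat_card, GaloisField.card 5 2 (by norm_num)]; norm_num
  have h8 : Fintype.card (GaloisField 5 2) % 8 = 1 := by rw [hc]
  have h5 : (5 : GaloisField 5 2) = 0 := by exact_mod_cast CharP.cast_eq_zero (GaloisField 5 2) 5
  have two := ff_two h8
  have sq : ∀ a : GaloisField 5 2, a ≠ 0 → (IsSquare a ↔ a ^ 12 = 1) := by
    intro a ha
    rw [FiniteField.isSquare_iff (ff_char h8) ha, hc]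
  have nsq : ∀ a : GaloisField 5 2, a ^ 12 = -1 → ¬ IsSquare a := by
    intro a ha h
    by_cases h0 : a = 0
    · rw [h0] at ha; norm_num at ha
    · rw [sq _ h0, ha] at h
      exact two (by linear_combination -h)
  obtain ⟨r, hr⟩ := ff_sq2 h8
  obtain ⟨w, hw⟩ : ∃ w : GaloisField 5 2, w ^ 2 + w + 1 = 0 :=
    ⟨3 * (r - 1), by linear_combination -9 * hr + (5 - 3 * r) * h5⟩
  have w3 : w ^ 3 = 1 := by linear_combination (w - 1) * hw
  have w0 : w ≠ 0 := by rintro rfl; simp at hw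
  have pm : ∀ e : GaloisField 5 2, e ≠ 0 → IsSquare e → e ^ 6 = 1 ∨ e ^ 6 = -1 := by
    intro e e0 he
    apply sq_eq_sq_iff_eq_or_eq_neg.1
    rw [← pow_mul, one_pow]; exact (sq e e0).1 he
  have flip : ∀ e : GaloisField 5 2, e ≠ 0 → IsSquare e → (-e ^ 6 = 1 ↔ ¬ e ^ 6 = 1) := by
    intro e e0 he
    rcases pm e e0 he with h | h <;> rw [h]
    · simp only [not_true_eq_false, iff_false]
      intro h'; exact two (by linear_combination -h')
    · simp only [neg_neg, true_iff]
      intro h'; exact two (by linear_combination -h')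
  refine system_of_color h8 (Fintype.equivFinOfCardEq hc) (x := 2) (y := 2 * w) two
    (mul_ne_zero two w0) (ff_sq2 h8) ((ff_sq2 h8).mul ⟨w ^ 2, by linear_combination -w * w3⟩) ?_ ?_
    (fun e => e ^ 6 = 1) ?_ ?_ ?_
  · apply nsq
    have h2 : ((1 + 2) * (1 + 2 * w)) ^ 2 = -2 := by linear_combination 36 * hw - 5 * h5
    rw [show (12 : ℕ) = 2 * 6 from rfl, pow_mul, h2]
    linear_combination 13 * h5
  · apply nsq
    have h1 : (2 * w - 2) * (1 - 2 * (2 * w)) = -2 * (w + 2) := by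
      linear_combination -8 * hw + (2 + 4 * w) * h5
    have h2 : (-2 * (w + 2)) ^ 2 = 3 * w ^ 2 := by
      linear_combination 16 * hw - 3 * w ^ 2 * h5
    rw [h1, show (12 : ℕ) = 2 * 6 from rfl, pow_mul, h2]
    linear_combination 729 * (w ^ 9 + w ^ 6 + w ^ 3 + 1) * w3 + 146 * h5
  · intro e _ _
    rw [Even.neg_pow (by decide)]
  · intro e e0 he
    rw [← flip e e0 he]
    rw [show (2 * e) ^ 6 = -e ^ 6 by linear_combination 13 * e ^ 6 * h5]
  · intro e e0 he
    rw [← flip e e0 he]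
    rw [show (2 * w * e) ^ 6 = -e ^ 6 by
      linear_combination 13 * e ^ 6 * h5 + 64 * e ^ 6 * (w ^ 3 + 1) * w3]

end small


/-- For a prime power `q ≡ 1 (mod 8)` which is not a power of 3 there exists a
strictly 4-sparse 4-cycle system of order `q`. -/
theorem exists_strictly_four_sparse_of_primePow (q : ℕ) (hq : IsPrimePow q)
    (h8 : q % 8 = 1) (h3 : ¬ ∃ n : ℕ, q = 3 ^ n) :
    ∃ C : Finset (Finset (Sym2 (Fin q))), IsFourCycleSystem C ∧ StrictlyRSparse 4 C := by
  obtain hgt | hle := lt_or_ge 57 q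
  · obtain ⟨p, k, hp, hk, rfl⟩ := hq
    haveI : Fact p.Prime := ⟨hp.nat_prime⟩
    letI : Fintype (GaloisField p k) := Fintype.ofFinite _
    have hc : Fintype.card (GaloisField p k) = p ^ k := by
      rw [Fintype.card_eq_nat_card, GaloisField.card p k hk.ne']
    rw [← hc] at h8 hgt
    obtain ⟨u, u0, n1, n2⟩ := exists_z h8 hgt
    exact system_of_z h8 (Fintype.equivFinOfCardEq hc) u0 n1 n2
  · have hcases : q = 1 ∨ q = 9 ∨ q = 17 ∨ q = 25 ∨ q = 33 ∨ q = 41 ∨ q = 49 ∨ q = 57 := by omega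
    have two_primes : ∀ a b : ℕ, a.Prime → b.Prime → a ≠ b → a ∣ q → b ∣ q → False := by
      intro a b ha hb hab h1 h2
      obtain ⟨p, -, hu⟩ := isPrimePow_iff_unique_prime_dvd.1 hq
      exact hab ((hu a ⟨ha, h1⟩).trans (hu b ⟨hb, h2⟩).symm)
    rcases hcases with rfl | rfl | rfl | rfl | rfl | rfl | rfl | rfl
    · exact (not_isPrimePow_one hq).elim
    · exact (h3 ⟨2, by norm_num⟩).elim
    · exact system_17
    · exact system_25
    · exact (two_primes 3 11 (by norm_num) (by norm_num) (by norm_num) (by norm_num)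
        (by norm_num)).elim
    · exact system_41
    · exact system_49
    · exact (two_primes 3 19 (by norm_num) (by norm_num) (by norm_num) (by norm_num)
        (by norm_num)).elim
end

section
/- Every (7,4)-configuration contains a jointed-diamond configuration as a substructure; that is, any set of four pairwise edge-disjoint 4-cycles whose union contains exactly 7 vertices has a subset of three of its 4-cycles forming a configuration isomorphic to the jointed-diamond. -/
open Finset

/-- `B` is a jointed-diamond configuration: the three 4-cycles
`(a,b,c,d)`, `(a,e,b,g)`, `(c,f,d,g)` on seven distinct vertices. -/
def IsJointedDiamond {V : Type*} [DecidableEq V] (B : Finset (Finset (Sym2 V))) : Prop :=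
  ∃ a b c d e f g : V, ([a, b, c, d, e, f, g] : List V).Nodup ∧
    B = {cycEdges a b c d, cycEdges a e b g, cycEdges c f d g}

namespace SevenFour

/-- A labelled 4-cycle with labels in `ℕ`. -/
structure Cyc where
  a : ℕ
  b : ℕ
  c : ℕ
  d : ℕ

/-- The edges of a labelled cycle. -/
def Cyc.edges (p : Cyc) : List (ℕ × ℕ) := [(p.a, p.b), (p.b, p.c), (p.c, p.d), (p.d, p.a)]

/-- Two labelled edges coincide. -/
def same (e f : ℕ × ℕ) : Bool :=
  (Nat.beq e.1 f.1 && Nat.beq e.2 f.2) || (Nat.beq e.1 f.2 && Nat.beq e.2 f.1)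

/-- Edge-disjointness of labelled cycles. -/
def disj (p q : Cyc) : Bool := p.edges.all fun e => q.edges.all fun f => !same e f

/-- Normal forms of a labelled 4-cycle. -/
def normal (p : Cyc) : Bool :=
  Nat.blt p.a p.b && Nat.blt p.a p.c && Nat.blt p.a p.d && Nat.blt p.b p.d &&
    !Nat.beq p.b p.c && !Nat.beq p.c p.d

/-- All 4-cycles on `{0, …, 6}`. -/
def cycles : List Cyc :=
  ([0, 1, 2, 3, 4, 5, 6] : List ℕ).flatMap fun a => [0, 1, 2, 3, 4, 5, 6].flatMap fun b =>
    [0, 1, 2, 3, 4, 5, 6].flatMap fun c => [0, 1, 2, 3, 4, 5, 6].flatMap fun d =>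
      bif normal ⟨a, b, c, d⟩ then [⟨a, b, c, d⟩] else []

/-- The rotations of a labelled cycle. -/
def Cyc.rots (p : Cyc) : List Cyc :=
  [p, ⟨p.b, p.c, p.d, p.a⟩, ⟨p.c, p.d, p.a, p.b⟩, ⟨p.d, p.a, p.b, p.c⟩]

/-- The dihedral images of a labelled cycle. -/
def Cyc.dihs (p : Cyc) : List Cyc := p.rots ++ Cyc.rots ⟨p.d, p.c, p.b, p.a⟩

/-- The labelled triple is a jointed diamond. -/
def isJD (p q r : Cyc) : Bool :=
  p.rots.any fun p => q.dihs.any fun q => Nat.beq q.a p.a && Nat.beq q.c p.b &&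
    r.dihs.any fun r => Nat.beq r.a p.c && Nat.beq r.c p.d && Nat.beq r.d q.d &&
      decide ([p.a, p.b, p.c, p.d, q.b, r.b, q.d].Nodup) &&
      [p.a, p.b, p.c, p.d, q.b, r.b, q.d].all fun i => Nat.blt i 7

/-- Some triple from the list is a jointed diamond. -/
def hasJD (l : List Cyc) : Bool := l.any fun p => l.any fun q => l.any fun r => isJD p q r

/-- Search through the edge-disjoint triples of cycles from a list. -/
def check (p : Cyc) (l : List Cyc) : Bool :=
  l.all fun x => (l.filter (disj x)).all fun y => ((l.filter (disj x)).filter (disj y)).all fun z =>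
    hasJD [p, x, y, z]

theorem check_true : check ⟨0, 1, 2, 3⟩ (cycles.filter (disj ⟨0, 1, 2, 3⟩)) = true := by
  decide +kernel

variable {V : Type*} [DecidableEq V]

/-- The edge set of the image of a labelled cycle. -/
def Cyc.img (g : ℕ → V) (p : Cyc) : Finset (Sym2 V) := cycEdges (g p.a) (g p.b) (g p.c) (g p.d)

theorem rot (a b c d : V) : cycEdges a b c d = cycEdges b c d a := by
  ext e
  simp only [cycEdges, mem_insert, mem_singleton]
  tauto

theorem flip (a b c d : V) : cycEdges a b c d = cycEdges d c b a := by
  ext e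
  simp only [cycEdges, mem_insert, mem_singleton, Sym2.eq_swap (a := d) (b := c),
    Sym2.eq_swap (a := c) (b := b), Sym2.eq_swap (a := b) (b := a), Sym2.eq_swap (a := a) (b := d)]
  tauto

theorem rots_img (g : ℕ → V) (p q : Cyc) (h : q ∈ p.rots) : q.img g = p.img g := by
  simp only [Cyc.rots, List.mem_cons, List.not_mem_nil, or_false] at h
  rcases h with rfl | rfl | rfl | rfl
  · rfl
  · simp only [Cyc.img]; rw [← rot]
  · simp only [Cyc.img]; rw [← rot, ← rot]
  · simp only [Cyc.img]; rw [rot]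

theorem dihs_img (g : ℕ → V) (p q : Cyc) (h : q ∈ p.dihs) : q.img g = p.img g := by
  rcases List.mem_append.1 h with h | h
  · exact rots_img g p q h
  · rw [rots_img g _ q h]
    simp only [Cyc.img]; rw [flip]

theorem edges_img (g : ℕ → V) (p : Cyc) (e : ℕ × ℕ) (h : e ∈ p.edges) :
    s(g e.1, g e.2) ∈ p.img g := by
  simp only [Cyc.edges, List.mem_cons, List.not_mem_nil, or_false] at h
  rcases h with rfl | rfl | rfl | rfl <;> simp [Cyc.img, cycEdges]

theorem disj_of (g : ℕ → V) (p q : Cyc) (h : Disjoint (p.img g) (q.img g)) : disj p q = true := by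
  simp only [disj, List.all_eq_true, Bool.not_eq_true']
  intro e he f hf
  by_contra hs
  have h1 := edges_img g p e he
  have h2 := edges_img g q f hf
  apply Finset.disjoint_left.1 h h1
  simp only [same, Bool.not_eq_false, Bool.or_eq_true, Bool.and_eq_true, Nat.beq_eq] at hs
  rcases hs with ⟨h3, h4⟩ | ⟨h3, h4⟩
  · rw [h3, h4]; exact h2
  · rw [h3, h4, Sym2.eq_swap]; exact h2

theorem mem_cycles (a b c d : ℕ) (ha : a < 7) (hb : b < 7) (hc : c < 7) (hd : d < 7)
    (h : normal ⟨a, b, c, d⟩ = true) : (⟨a, b, c, d⟩ : Cyc) ∈ cycles := by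
  have key : ∀ x : ℕ, x < 7 → x ∈ [0, 1, 2, 3, 4, 5, 6] := by
    intro x hx
    simp only [List.mem_cons, List.not_mem_nil, or_false]
    omega
  simp only [cycles, List.mem_flatMap]
  exact ⟨a, key a ha, b, key b hb, c, key c hc, d, key d hd, by simp [h]⟩

theorem beq_false (x y : ℕ) (h : x ≠ y) : Nat.beq x y = false := by
  rw [← Bool.not_eq_true, Nat.beq_eq]
  exact h

theorem exists_half (g : ℕ → V) (a b c d : ℕ) (ha : a < 7) (hb : b < 7) (hc : c < 7) (hd : d < 7)
    (h1 : a < b) (h2 : a < c) (h3 : a < d) (h4 : b ≠ c) (h5 : b ≠ d) (h6 : c ≠ d) :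
    ∃ p ∈ cycles, p.img g = cycEdges (g a) (g b) (g c) (g d) := by
  rcases lt_or_gt_of_ne h5 with h | h
  · refine ⟨⟨a, b, c, d⟩, mem_cycles a b c d ha hb hc hd ?_, rfl⟩
    simp [normal, Nat.blt_eq, h, h1, h2, h3, beq_false b c h4, beq_false c d h6]
  · refine ⟨⟨a, d, c, b⟩, mem_cycles a d c b ha hd hc hb ?_, ?_⟩
    · simp [normal, Nat.blt_eq, h, h1, h2, h3, beq_false c b h4.symm, beq_false d c h6.symm]
    · simp only [Cyc.img]
      rw [flip, rot, rot, rot]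

theorem exists_cycle (g : ℕ → V) (a b c d : ℕ) (ha : a < 7) (hb : b < 7) (hc : c < 7) (hd : d < 7)
    (h : [a, b, c, d].Nodup) :
    ∃ p ∈ cycles, p.img g = cycEdges (g a) (g b) (g c) (g d) := by
  simp only [List.nodup_cons, List.mem_cons, List.not_mem_nil, or_false, not_or] at h
  obtain ⟨⟨h1, h2, h3⟩, ⟨h4, h5⟩, h6, -⟩ := h
  have hm : (a < b ∧ a < c ∧ a < d) ∨ (b < a ∧ b < c ∧ b < d) ∨ (c < a ∧ c < b ∧ c < d) ∨
      (d < a ∧ d < b ∧ d < c) := by omega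
  rcases hm with ⟨m1, m2, m3⟩ | ⟨m1, m2, m3⟩ | ⟨m1, m2, m3⟩ | ⟨m1, m2, m3⟩
  · exact exists_half g a b c d ha hb hc hd m1 m2 m3 h4 h5 h6
  · rw [rot]
    exact exists_half g b c d a hb hc hd ha m2 m3 m1 h6 (Ne.symm h2) (Ne.symm h3)
  · rw [rot, rot]
    exact exists_half g c d a b hc hd ha hb m3 m1 m2 (Ne.symm h3) (Ne.symm h5) h1
  · rw [rot, rot, rot]
    exact exists_half g d a b c hd ha hb hc m1 m2 m3 h1 h2 h4

theorem verts (a b c d : V) : edgeVerts (cycEdges a b c d) = {a, b, c, d} := by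
  ext x
  simp [edgeVerts, cycEdges]
  tauto

theorem card_jd (a b c d e f g : V) (h : [a, b, c, d, e, f, g].Nodup) :
    ({cycEdges a b c d, cycEdges a e b g, cycEdges c f d g} : Finset (Finset (Sym2 V))).card = 3 := by
  simp only [List.nodup_cons, List.mem_cons, List.not_mem_nil, or_false, not_or] at h
  have h1 : s(a, b) ∈ cycEdges a b c d := by simp [cycEdges]
  have h2 : s(a, e) ∈ cycEdges a e b g := by simp [cycEdges]
  have h3 : s(a, b) ∉ cycEdges a e b g := by simp [cycEdges]; grind
  have h4 : s(a, b) ∉ cycEdges c f d g := by simp [cycEdges]; grind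
  have h5 : s(a, e) ∉ cycEdges c f d g := by simp [cycEdges]; grind
  rw [Finset.card_eq_three]
  refine ⟨cycEdges a b c d, cycEdges a e b g, cycEdges c f d g, fun h => h3 (h ▸ h1), fun h => h4 (h ▸ h1), fun h => h5 (h ▸ h2), rfl⟩

theorem isJD_sound (g : ℕ → V) (hg : ∀ x < 7, ∀ y < 7, g x = g y → x = y) (p q r : Cyc)
    (h : isJD p q r = true) :
    ({p.img g, q.img g, r.img g} : Finset (Finset (Sym2 V))).card = 3 ∧
      IsJointedDiamond {p.img g, q.img g, r.img g} := by
  simp only [isJD, List.any_eq_true, Bool.and_eq_true, Nat.beq_eq, decide_eq_true_eq,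
    List.all_eq_true, Nat.blt_eq] at h
  obtain ⟨p', hp, q', hq, ⟨e1, e2⟩, r', hr, ⟨⟨⟨e3, e4⟩, e5⟩, hn⟩, hl⟩ := h
  have hn' := List.Nodup.map_on (f := g) (fun x hx y hy => hg x (hl x hx) y (hl y hy)) hn
  simp only [List.map_cons, List.map_nil] at hn'
  rw [← rots_img g p p' hp, ← dihs_img g q q' hq, ← dihs_img g r r' hr]
  simp only [Cyc.img, e1, e2, e3, e4, e5]
  exact ⟨card_jd _ _ _ _ _ _ _ hn', _, _, _, _, _, _, _, hn', rfl⟩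

end SevenFour

/-- Every `(7,4)`-configuration contains a jointed-diamond configuration. -/
theorem seven_four_contains_jointed_diamond {V : Type*} [DecidableEq V]
    (A : Finset (Finset (Sym2 V))) (hA : IsConfiguration 7 4 A) :
    ∃ B ⊆ A, B.card = 3 ∧ IsJointedDiamond B := by
  obtain ⟨hc, h4, hd, h7⟩ := hA
  obtain ⟨E1, E2, E3, E4, h12, h13, h14, h23, h24, h34, rfl⟩ := Finset.card_eq_four.1 hc
  obtain ⟨a, b, c, d, hn, hE1⟩ := h4 E1 (by simp)
  generalize hS : (({E1, E2, E3, E4} : Finset (Finset (Sym2 V))).sup edgeVerts) = S at h7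
  have hsub : ∀ E ∈ ({E1, E2, E3, E4} : Finset (Finset (Sym2 V))), edgeVerts E ⊆ S := by
    intro E hE
    rw [← hS]
    exact Finset.le_sup (f := edgeVerts) hE
  have hT : ({a, b, c, d} : Finset V) ⊆ S := by
    rw [← SevenFour.verts, ← hE1]
    exact hsub E1 (by simp)
  have hn0 := hn
  simp only [List.nodup_cons, List.mem_cons, List.not_mem_nil, or_false, not_or] at hn0
  have hT4 : ({a, b, c, d} : Finset V).card = 4 :=
    Finset.card_eq_four.2 ⟨a, b, c, d, hn0.1.1, hn0.1.2.1, hn0.1.2.2, hn0.2.1.1, hn0.2.1.2,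
      hn0.2.2.1, rfl⟩
  have h3 : (S \ {a, b, c, d}).card = 3 := by
    rw [Finset.card_sdiff_of_subset hT, h7, hT4]
  obtain ⟨e, f, k, hef, hek, hfk, hR⟩ := Finset.card_eq_three.1 h3
  have he : e ∈ S \ {a, b, c, d} := by rw [hR]; simp
  have hf : f ∈ S \ {a, b, c, d} := by rw [hR]; simp
  have hk : k ∈ S \ {a, b, c, d} := by rw [hR]; simp
  simp only [Finset.mem_sdiff, Finset.mem_insert, Finset.mem_singleton, not_or] at he hf hk
  have hnd : [a, b, c, d, e, f, k].Nodup := by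
    simp only [List.nodup_cons, List.mem_cons, List.not_mem_nil, or_false, not_or]
    grind
  obtain ⟨g, hgdef⟩ : ∃ g : ℕ → V, g = fun n => [a, b, c, d, e, f, k].getD n a := ⟨_, rfl⟩
  have hg : ∀ x < 7, ∀ y < 7, g x = g y → x = y := by
    intro x hx y hy hxy
    have hx' : x < [a, b, c, d, e, f, k].length := hx
    have hy' : y < [a, b, c, d, e, f, k].length := hy
    simp only [hgdef, List.getD_eq_getElem _ _ hx', List.getD_eq_getElem _ _ hy'] at hxy
    exact (hnd.getElem_inj_iff).1 hxy
  have hsurj : ∀ v ∈ S, ∃ x < 7, g x = v := by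
    intro v hv
    by_cases hvT : v ∈ ({a, b, c, d} : Finset V)
    · simp only [Finset.mem_insert, Finset.mem_singleton] at hvT
      rcases hvT with rfl | rfl | rfl | rfl
      · exact ⟨0, by norm_num, by simp [hgdef]⟩
      · exact ⟨1, by norm_num, by simp [hgdef]⟩
      · exact ⟨2, by norm_num, by simp [hgdef]⟩
      · exact ⟨3, by norm_num, by simp [hgdef]⟩
    · have hv' : v ∈ S \ {a, b, c, d} := Finset.mem_sdiff.2 ⟨hv, hvT⟩
      rw [hR] at hv'
      simp only [Finset.mem_insert, Finset.mem_singleton] at hv'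
      rcases hv' with rfl | rfl | rfl
      · exact ⟨4, by norm_num, by simp [hgdef]⟩
      · exact ⟨5, by norm_num, by simp [hgdef]⟩
      · exact ⟨6, by norm_num, by simp [hgdef]⟩
  have hlab : ∀ E ∈ ({E1, E2, E3, E4} : Finset (Finset (Sym2 V))),
      ∃ p ∈ SevenFour.cycles, p.img g = E := by
    intro E hE
    obtain ⟨w, x, y, z, hw, hEq⟩ := h4 E hE
    have hv := hsub E hE
    rw [hEq, SevenFour.verts] at hv
    obtain ⟨w', hw', rfl⟩ := hsurj w (hv (by simp))
    obtain ⟨x', hx', rfl⟩ := hsurj x (hv (by simp))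
    obtain ⟨y', hy', rfl⟩ := hsurj y (hv (by simp))
    obtain ⟨z', hz', rfl⟩ := hsurj z (hv (by simp))
    rw [hEq]
    exact SevenFour.exists_cycle g w' x' y' z' hw' hx' hy' hz'
      (List.Nodup.of_map g (l := [w', x', y', z']) hw)
  have hP : (SevenFour.Cyc.mk 0 1 2 3).img g = E1 := by
    rw [hE1]
    simp [SevenFour.Cyc.img, hgdef]
  obtain ⟨p2, hp2, rfl⟩ := hlab E2 (by simp)
  obtain ⟨p3, hp3, rfl⟩ := hlab E3 (by simp)
  obtain ⟨p4, hp4, rfl⟩ := hlab E4 (by simp)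
  have d12 := SevenFour.disj_of g ⟨0, 1, 2, 3⟩ p2
    (by rw [hP]; exact hd _ (by simp) _ (by simp) h12)
  have d13 := SevenFour.disj_of g ⟨0, 1, 2, 3⟩ p3
    (by rw [hP]; exact hd _ (by simp) _ (by simp) h13)
  have d14 := SevenFour.disj_of g ⟨0, 1, 2, 3⟩ p4
    (by rw [hP]; exact hd _ (by simp) _ (by simp) h14)
  have d23 := SevenFour.disj_of g p2 p3 (hd _ (by simp) _ (by simp) h23)
  have d24 := SevenFour.disj_of g p2 p4 (hd _ (by simp) _ (by simp) h24)
  have d34 := SevenFour.disj_of g p3 p4 (hd _ (by simp) _ (by simp) h34)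
  have hcheck := SevenFour.check_true
  simp only [SevenFour.check, List.all_eq_true, List.mem_filter] at hcheck
  have hJ := hcheck p2 ⟨hp2, d12⟩ p3 ⟨⟨hp3, d13⟩, d23⟩ p4 ⟨⟨⟨hp4, d14⟩, d24⟩, d34⟩
  simp only [SevenFour.hasJD, List.any_eq_true] at hJ
  obtain ⟨p, hp, q, hq, r, hr, hJ⟩ := hJ
  have hmem : ∀ t ∈ [SevenFour.Cyc.mk 0 1 2 3, p2, p3, p4],
      t.img g ∈ ({E1, p2.img g, p3.img g, p4.img g} : Finset (Finset (Sym2 V))) := by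
    intro t ht
    simp only [List.mem_cons, List.not_mem_nil, or_false] at ht
    rcases ht with rfl | rfl | rfl | rfl
    · rw [hP]; simp
    · simp
    · simp
    · simp
  obtain ⟨hcard, hjd⟩ := SevenFour.isJD_sound g hg p q r hJ
  refine ⟨{p.img g, q.img g, r.img g}, ?_, hcard, hjd⟩
  intro t ht
  rw [Finset.mem_insert, Finset.mem_insert, Finset.mem_singleton] at ht
  rcases ht with rfl | rfl | rfl
  · exact hmem p hp
  · exact hmem q hq
  · exact hmem r hr
end

section
/- Let a,b,c,d be four distinct symbols and consider the complete multipartite graph K_{2,2,2,2} on the vertex set {a,b,c,d} × {0,1}, with parts {x} × {0,1} for x ∈ {a,b,c,d}. The eight 4-cycles obtained by developing the 4-cycle ((a,0),(b,0),(c,1),(d,0)) under the group generated by the permutation fixing d and cyclically permuting (a b c) in the first coordinate, together with Z_2 acting on the second coordinate, form a decomposition of the edge set of K_{2,2,2,2} into edge-disjoint 4-cycles; moreover this collection of 4-cycles contains no two 4-cycles sharing a common diagonal and contains no jointed-diamond configuration. -/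
open Finset

/-- `p` is a diagonal of the 4-cycle `E`. -/
def IsDiagonalOf {V : Type*} [DecidableEq V] (p : Sym2 V) (E : Finset (Sym2 V)) : Prop :=
  ∃ a b c d : V, ([a, b, c, d] : List V).Nodup ∧ E = cycEdges a b c d ∧
    (p = s(a, c) ∨ p = s(b, d))

/-- The permutation of the four parts fixing `d = 3` and cyclically permuting
`(a b c) = (0 1 2)`. -/
def partPerm : Fin 4 → Fin 4 := ![1, 2, 0, 3]

/-- Development of a vertex of `K_{2,2,2,2}` by `i` applications of `partPerm` on the
first coordinate and translation by `j` in `Z_2` on the second coordinate. -/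
def devMap (i : Fin 3) (j : ZMod 2) (p : Fin 4 × ZMod 2) : Fin 4 × ZMod 2 :=
  (partPerm^[(i : ℕ)] p.1, p.2 + j)

/-- The 4-cycles obtained by developing `((a,0), (b,0), (c,1), (d,0))` under the group
`⟨(d)(a b c)⟩ × Z_2`, where `a = 0`, `b = 1`, `c = 2`, `d = 3`. -/
def devCycles : Finset (Finset (Sym2 (Fin 4 × ZMod 2))) :=
  (Finset.univ : Finset (Fin 3 × ZMod 2)).image fun ij =>
    cycEdges (devMap ij.1 ij.2 (0, 0)) (devMap ij.1 ij.2 (1, 0))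
      (devMap ij.1 ij.2 (2, 1)) (devMap ij.1 ij.2 (3, 0))

/-- The developed cycle with index `ij`. -/
def devCyc (ij : Fin 3 × ZMod 2) : Finset (Sym2 (Fin 4 × ZMod 2)) :=
  cycEdges (devMap ij.1 ij.2 (0, 0)) (devMap ij.1 ij.2 (1, 0))
    (devMap ij.1 ij.2 (2, 1)) (devMap ij.1 ij.2 (3, 0))

theorem mem_devCycles_iff (E : Finset (Sym2 (Fin 4 × ZMod 2))) :
    E ∈ devCycles ↔ ∃ ij, devCyc ij = E := by
  simp only [devCycles, Finset.mem_image, Finset.mem_univ, true_and, devCyc]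

theorem devCyc_nodup : ∀ ij : Fin 3 × ZMod 2,
    ([devMap ij.1 ij.2 (0, 0), devMap ij.1 ij.2 (1, 0),
    devMap ij.1 ij.2 (2, 1), devMap ij.1 ij.2 (3, 0)] : List (Fin 4 × ZMod 2)).Nodup := by
  decide +kernel

theorem devCyc_parts : ∀ ij : Fin 3 × ZMod 2, ∀ u v : Fin 4 × ZMod 2,
    s(u, v) ∈ devCyc ij → u.1 ≠ v.1 := by
  decide +kernel

theorem devCyc_unique : ∀ u v : Fin 4 × ZMod 2, u.1 ≠ v.1 →
    ∃ ij, s(u, v) ∈ devCyc ij ∧ ∀ kl, s(u, v) ∈ devCyc kl → kl = ij := by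
  decide +kernel

set_option synthInstance.maxHeartbeats 2000000 in
set_option synthInstance.maxSize 10000 in
set_option maxHeartbeats 2000000 in
/-- Two developed cycles with a 2-path between the same two endpoints coincide. -/
theorem devCyc_diag : ∀ ij : Fin 3 × ZMod 2, ∀ a b : Fin 4 × ZMod 2, s(a, b) ∈ devCyc ij →
    ∀ c, s(b, c) ∈ devCyc ij → a ≠ c → ∀ kl, ∀ y, s(a, y) ∈ devCyc kl →
    s(y, c) ∈ devCyc kl → ij = kl := by
  decide +kernel

set_option synthInstance.maxHeartbeats 2000000 in
set_option synthInstance.maxSize 10000 in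
set_option maxHeartbeats 2000000 in
theorem devCyc_joint : ∀ ij : Fin 3 × ZMod 2, ∀ a b : Fin 4 × ZMod 2, s(a, b) ∈ devCyc ij →
    ∀ c, s(b, c) ∈ devCyc ij → a ≠ c → ∀ d, s(c, d) ∈ devCyc ij → b ≠ d →
    ∀ kl, ∀ g, s(b, g) ∈ devCyc kl → s(g, a) ∈ devCyc kl →
    ∀ mn, s(d, g) ∈ devCyc mn → s(g, c) ∈ devCyc mn → False := by
  decide +kernel

/-- A diagonal of a 4-cycle joins the ends of a 2-path of the cycle. -/
theorem IsDiagonalOf.exists_path {V : Type*} [DecidableEq V] {p : Sym2 V}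
    {E : Finset (Sym2 V)} (h : IsDiagonalOf p E) :
    ∃ x y z, p = s(x, z) ∧ x ≠ z ∧ s(x, y) ∈ E ∧ s(y, z) ∈ E := by
  obtain ⟨a, b, c, d, hn, rfl, rfl | rfl⟩ := h
  · refine ⟨a, b, c, rfl, ?_, ?_, ?_⟩
    · rintro rfl; simp at hn
    · simp [cycEdges]
    · simp [cycEdges]
  · refine ⟨b, c, d, rfl, ?_, ?_, ?_⟩
    · rintro rfl; simp at hn
    · simp [cycEdges]
    · simp [cycEdges]

/-- The developed 4-cycles decompose the edge set of `K_{2,2,2,2}` (edges are the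
pairs of vertices lying in different parts) into edge-disjoint 4-cycles; no two of
the 4-cycles share a common diagonal, and no three form a jointed-diamond. -/
theorem devCycles_decompose_K2222 :
    (∀ E ∈ devCycles, IsFourCycle E) ∧
    (∀ E ∈ devCycles, ∀ e ∈ E, ∀ u v : Fin 4 × ZMod 2, e = s(u, v) → u.1 ≠ v.1) ∧
    (∀ u v : Fin 4 × ZMod 2, u.1 ≠ v.1 → ∃! E, E ∈ devCycles ∧ s(u, v) ∈ E) ∧
    (∀ E ∈ devCycles, ∀ F ∈ devCycles, E ≠ F →
      ∀ p : Sym2 (Fin 4 × ZMod 2), IsDiagonalOf p E → ¬ IsDiagonalOf p F) ∧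
    (∀ B ⊆ devCycles, ¬ IsJointedDiamond B) := by
  refine ⟨?_, ?_, ?_, ?_, ?_⟩
  · intro E hE
    obtain ⟨ij, rfl⟩ := (mem_devCycles_iff E).1 hE
    exact ⟨_, _, _, _, devCyc_nodup ij, rfl⟩
  · rintro E hE e he u v rfl
    obtain ⟨ij, rfl⟩ := (mem_devCycles_iff E).1 hE
    exact devCyc_parts ij u v he
  · intro u v huv
    obtain ⟨ij, h1, h2⟩ := devCyc_unique u v huv
    refine ⟨devCyc ij, ⟨(mem_devCycles_iff _).2 ⟨ij, rfl⟩, h1⟩, ?_⟩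
    rintro F ⟨hF, hm⟩
    obtain ⟨kl, rfl⟩ := (mem_devCycles_iff F).1 hF
    rw [h2 kl hm]
  · intro E hE F hF hne p hp hq
    obtain ⟨ij, rfl⟩ := (mem_devCycles_iff E).1 hE
    obtain ⟨kl, rfl⟩ := (mem_devCycles_iff F).1 hF
    obtain ⟨x, y, z, rfl, hxz, h1, h2⟩ := hp.exists_path
    obtain ⟨x', y', z', he, -, h3, h4⟩ := hq.exists_path
    apply hne
    rcases Sym2.eq_iff.1 he with ⟨rfl, rfl⟩ | ⟨rfl, rfl⟩
    · rw [devCyc_diag ij x y h1 z h2 hxz kl y' h3 h4]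
    · rw [Sym2.eq_swap] at h3 h4
      rw [devCyc_diag ij x y h1 z h2 hxz kl y' h4 h3]
  · rintro B hB ⟨a, b, c, d, e, f, g, hn, rfl⟩
    obtain ⟨ij, hE⟩ := (mem_devCycles_iff (cycEdges a b c d)).1 (hB (by simp))
    obtain ⟨kl, hF⟩ := (mem_devCycles_iff (cycEdges a e b g)).1 (hB (by simp))
    obtain ⟨mn, hG⟩ := (mem_devCycles_iff (cycEdges c f d g)).1 (hB (by simp))
    have hac : a ≠ c := by rintro rfl; simp at hn
    have hbd : b ≠ d := by rintro rfl; simp at hn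
    exact devCyc_joint ij a b (by rw [hE]; simp [cycEdges]) c (by rw [hE]; simp [cycEdges]) hac
      d (by rw [hE]; simp [cycEdges]) hbd kl g (by rw [hF]; simp [cycEdges])
      (by rw [hF]; simp [cycEdges]) mn (by rw [hG]; simp [cycEdges])
      (by rw [hG]; simp [cycEdges])
end
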